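/- arXiv:2509.00273 — 4 statements merged into one kernel-verified Lean document; each statement's English description precedes it below -/
import Mathlib

section
/- Let ℓ and p be distinct primes with ℓ ≡ p ≡ 1 (mod 4), assume p is a primitive root modulo ℓ, and set g = (ℓ−1)/2. Then the characteristic polynomial of the p-power Frobenius on the Jacobian of H_ℓ is X^{2g} + p^g; equivalently, for every n ≥ 1: if (ℓ−1) ∤ n then #{(x,y) ∈ 𝔽_{p^n} × 𝔽_{p^n} : y² = φ_ℓ(x)} = p^n, and if (ℓ−1) | n then #{(x,y) ∈ 𝔽_{p^n} × 𝔽_{p^n} : y² = φ_ℓ(x)} = p^n − (ℓ−1)·(−1)^{n/(ℓ−1)}·p^{n/2}. -/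
open Polynomial

/-- Number of affine points (x,y) ∈ F × F with y² = φ_d(x), where φ_d is the
d-th Chebyshev (Dickson first kind, parameter 1) polynomial over F. -/
noncomputable def chebAffineCount (F : Type) [Field F] (d : ℕ) : ℕ :=
  Nat.card {xy : F × F // xy.2 ^ 2 = (dickson 1 (1 : F) d).eval xy.1}

/-- The hyperelliptic curve H_d : y² = φ_d(x) is maximal over the field with q² elements:
its affine point count attains q² + (d-1)q (Hasse–Weil bound minus the point at infinity). -/
def chebMaximal (d q : ℕ) : Prop :=
  ∀ (F : Type) [Field F] [Fintype F], Fintype.card F = q ^ 2 →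
    chebAffineCount F d = q ^ 2 + (d - 1) * q


namespace ChebAux

open Classical in
lemma card_fiber_pow {G : Type*} [CommGroup G] [Fintype G] [IsCyclic G] {l : ℕ}
    (hd : l ∣ Fintype.card G) (t₀ : G) :
    (Finset.univ.filter (fun t : G => t ^ l = t₀ ^ l)).card = l := by
  have h1 := IsCyclic.card_powMonoidHom_ker (G := G) l
  rw [Nat.card_eq_fintype_card (α := G), Nat.gcd_eq_right hd] at h1
  have h2 : Nat.card (powMonoidHom l : G →* G).ker
      = (Finset.univ.filter (fun t : G => t ^ l = 1)).card := by
    rw [Nat.card_eq_fintype_card, Fintype.card_subtype]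
    congr 1
    ext x
    simp [MonoidHom.mem_ker]
  rw [h2] at h1
  conv_rhs => rw [← h1]
  refine Finset.card_bij (fun t _ => t * t₀⁻¹) ?_ ?_ ?_
  · intro a ha
    simp only [Finset.mem_filter, Finset.mem_univ, true_and] at ha ⊢
    rw [mul_pow, ha, ← mul_pow, mul_inv_cancel, one_pow]
  · intro a _ b _ h
    exact mul_right_cancel h
  · intro b hb
    simp only [Finset.mem_filter, Finset.mem_univ, true_and] at hb
    exact ⟨b * t₀, by simp [mul_pow, hb], by simp⟩

open Classical in
lemma sum_pow_fiber {G : Type*} [CommGroup G] [Fintype G] {R : Type*} [CommRing R] (l : ℕ)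
    (h : G → R) :
    ∑ t : G, h (t ^ l) = ∑ s : G, ((Finset.univ.filter (fun t : G => t ^ l = s)).card : R) * h s := by
  rw [← Finset.sum_fiberwise Finset.univ (fun t : G => t ^ l)]
  refine Finset.sum_congr rfl fun s _ => ?_
  rw [Finset.sum_congr rfl (g := fun _ => h s)]
  · simp
  · intro x hx
    rw [(Finset.mem_filter.1 hx).2]

lemma dvd_sum_pow {G : Type*} [CommGroup G] [Fintype G] [IsCyclic G] {l : ℕ}
    (hd : l ∣ Fintype.card G) (h : G → ℤ) : (l : ℤ) ∣ ∑ t : G, h (t ^ l) := by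
  classical
  rw [sum_pow_fiber]
  refine Finset.dvd_sum fun s _ => ?_
  by_cases hs : ∃ t₀, t₀ ^ l = s
  · obtain ⟨t₀, rfl⟩ := hs
    rw [card_fiber_pow hd]
    exact dvd_mul_right _ _
  · rw [Finset.filter_false_of_mem]
    · simp
    · intro x _ hx
      exact hs ⟨x, hx⟩

lemma sum_pow_char {G : Type*} [CommGroup G] [Fintype G] [IsCyclic G] {R : Type*} [CommRing R]
    [IsDomain R] {l : ℕ} (hl : l.Prime)
    (hd : l ∣ Fintype.card G) (ψ : G →* R) (hψ : ψ ≠ 1) (hψl : ∀ s, ψ s ^ l = 1) (h : G → R) :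
    ∑ t : G, h (t ^ l) = ∑ k ∈ Finset.range l, ∑ s : G, ψ s ^ k * h s := by
  classical
  rw [sum_pow_fiber, Finset.sum_comm]
  refine Finset.sum_congr rfl fun s _ => ?_
  rw [← Finset.sum_mul]
  congr 1
  by_cases hs : ∃ t₀, t₀ ^ l = s
  · obtain ⟨t₀, rfl⟩ := hs
    rw [card_fiber_pow hd]
    simp [hψl]
  · rw [Finset.filter_false_of_mem]
    · have h1 : ψ s ≠ 1 := by
        intro h1
        obtain ⟨g, hg⟩ := IsCyclic.exists_monoid_generator (α := G)
        obtain ⟨i, rfl⟩ := (Submonoid.mem_powers_iff _ _).1 (hg s)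
        have hg1 : ψ g ≠ 1 := by
          intro hg1
          apply hψ
          ext x
          obtain ⟨j, rfl⟩ := (Submonoid.mem_powers_iff _ _).1 (hg x)
          simp [hg1]
        have ho : orderOf (ψ g) = l := orderOf_eq_prime (hψl g) hg1 (hp := ⟨hl⟩)
        rw [map_pow] at h1
        obtain ⟨c, hc⟩ := ho ▸ orderOf_dvd_of_pow_eq_one h1
        exact hs ⟨g ^ c, by rw [← pow_mul, hc, mul_comm]⟩
      have h2 := mul_geom_sum (ψ s) l
      rw [hψl, sub_self] at h2
      rcases mul_eq_zero.1 h2 with h3 | h3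
      · exact absurd (sub_eq_zero.1 h3) h1
      · rw [h3]; simp
    · intro x _ hx
      exact hs ⟨x, hx⟩

lemma sum_frob {G : Type*} [CommGroup G] [Fintype G] {R : Type*} [CommRing R] {p : ℕ}
    (hp : (Fintype.card G).Coprime p) (ψ : G →* R) (h : G → R) (hh : ∀ s, h (s ^ p) = h s) (i : ℕ) :
    ∑ s : G, ψ s ^ (p ^ i) * h s = ∑ s : G, ψ s * h s := by
  induction i with
  | zero => simp
  | succ i ih =>
    rw [← ih, ← Equiv.sum_comp (powCoprime (G := G) (n := p) (by rwa [Nat.card_eq_fintype_card]))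
      (fun s => ψ s ^ (p ^ i) * h s)]
    refine Finset.sum_congr rfl fun s _ => ?_
    simp only [powCoprime_apply, hh, map_pow]
    rw [← pow_mul, pow_succ', ]

lemma master {G : Type*} [CommGroup G] [Fintype G] [IsCyclic G] {R : Type*} [CommRing R]
    [IsDomain R] {l p : ℕ} (hl : l.Prime) (hp : (Fintype.card G).Coprime p)
    (hgen : ∀ k, ¬ l ∣ k → ∃ i, p ^ i ≡ k [MOD l])
    (hd : l ∣ Fintype.card G) (ψ : G →* R) (hψ : ψ ≠ 1) (hψl : ∀ s, ψ s ^ l = 1) (h : G → R)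
    (hh : ∀ s, h (s ^ p) = h s) :
    ∑ t : G, h (t ^ l) - ∑ s : G, h s = ((l : R) - 1) * ∑ s : G, ψ s * h s := by
  rw [sum_pow_char hl hd ψ hψ hψl]
  obtain ⟨l, rfl⟩ : ∃ l', l = l' + 1 := ⟨l - 1, by have := hl.pos; omega⟩
  rw [Finset.sum_range_succ']
  simp only [pow_zero, one_mul, add_sub_cancel_right]
  rw [Finset.sum_congr rfl (g := fun _ => ∑ s : G, ψ s * h s)]
  · simp
  · intro k hk
    obtain ⟨i, hi⟩ := hgen (k + 1) (by
      intro hdvd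
      have := Nat.le_of_dvd (by omega) hdvd
      have := Finset.mem_range.1 hk
      omega)
    rw [← sum_frob hp ψ h hh i]
    refine Finset.sum_congr rfl fun s _ => ?_
    congr 1
    rw [pow_eq_pow_mod _ (hψl s), ← hi, ← pow_eq_pow_mod _ (hψl s)]

end ChebAux

namespace ChebAux

lemma digit_bound {p n : ℕ} (hp : 1 < p) (j : ℕ) :
    (p - 1) * ∑ i ∈ Finset.range n, (p ^ i * j % (p ^ n - 1)) ≤ (p ^ n - 1) * (p.digits j).sum := by
  induction j using Nat.strong_induction_on with
  | _ j ih =>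
  rcases Nat.eq_zero_or_pos j with rfl | hj
  · simp
  rw [Nat.digits_def' hp hj, List.sum_cons, mul_add]
  have h1 := ih (j / p) (Nat.div_lt_self hj hp)
  have hgeom : (p - 1) * ∑ i ∈ Finset.range n, p ^ i = p ^ n - 1 := by
    have h := Nat.geomSum_eq hp n
    rw [h]
    exact Nat.mul_div_cancel' (Nat.sub_one_dvd_pow_sub_one p n)
  have h2 : ∑ i ∈ Finset.range n, (p ^ i * j % (p ^ n - 1)) ≤
      ∑ i ∈ Finset.range n, (p ^ i * (j % p) + p ^ (i + 1) * (j / p) % (p ^ n - 1)) := by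
    refine Finset.sum_le_sum fun i _ => ?_
    have : p ^ i * j = p ^ i * (j % p) + p ^ (i + 1) * (j / p) := by
      conv_lhs => rw [← Nat.mod_add_div j p]
      ring
    rw [this, Nat.add_mod]
    exact (Nat.mod_le _ _).trans (Nat.add_le_add_right (Nat.mod_le _ _) _)
  have h3 : ∑ i ∈ Finset.range n, (p ^ (i + 1) * (j / p) % (p ^ n - 1)) =
      ∑ i ∈ Finset.range n, (p ^ i * (j / p) % (p ^ n - 1)) := by
    have e1 := Finset.sum_range_succ' (fun i => p ^ i * (j / p) % (p ^ n - 1)) n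
    have e2 := Finset.sum_range_succ (fun i => p ^ i * (j / p) % (p ^ n - 1)) n
    have e3 : p ^ n * (j / p) % (p ^ n - 1) = p ^ 0 * (j / p) % (p ^ n - 1) := by
      have : 0 < p ^ n := by positivity
      obtain ⟨c, hc⟩ : ∃ c, p ^ n = c + 1 := ⟨p ^ n - 1, by omega⟩
      rw [hc]
      simp [add_mul]
    omega
  rw [Finset.sum_add_distrib, h3, ← Finset.sum_mul] at h2
  calc _ ≤ (p - 1) * _ := Nat.mul_le_mul_left _ h2
    _ = ((p - 1) * ∑ i ∈ Finset.range n, p ^ i) * (j % p)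
        + (p - 1) * ∑ i ∈ Finset.range n, (p ^ i * (j / p) % (p ^ n - 1)) := by ring
    _ ≤ _ := by rw [hgeom]; exact Nat.add_le_add_left h1 _

lemma sum_residues_base {l p : ℕ} (hl : l.Prime) (hl4 : l % 4 = 1) (hp4 : p % 4 = 1)
    (hord : orderOf (p : ZMod l) = l - 1) (j : ℕ) (hj : ¬ l ∣ j) :
    ∑ i ∈ Finset.range (l - 1), (p ^ i * j % (4 * l)) = 2 * l * (l - 1) := by
  have := Fact.mk hl
  have hl1 := hl.one_lt
  have hmodl : ∀ i, ((p ^ i * j % (4 * l) : ℕ) : ZMod l) = (p : ZMod l) ^ i * j := by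
    intro i
    have : ((p ^ i * j % (4 * l) : ℕ) : ZMod l) = ((p ^ i * j : ℕ) : ZMod l) := by
      rw [ZMod.natCast_eq_natCast_iff']
      exact Nat.mod_mod_of_dvd _ (dvd_mul_left _ _)
    rw [this]; push_cast; rfl
  have hmod4 : ∀ i, (p ^ i * j % (4 * l)) % 4 = j % 4 := by
    intro i
    rw [Nat.mod_mod_of_dvd _ (dvd_mul_right _ _), Nat.mul_mod, Nat.pow_mod, hp4]
    simp
  have hj0 : (j : ZMod l) ≠ 0 := by rwa [Ne, ZMod.natCast_eq_zero_iff]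
  have hp0 : (p : ZMod l) ≠ 0 := by
    intro h0
    rw [h0] at hord
    have h2 : orderOf (0 : ZMod l) = 0 := orderOf_zero _
    omega
  have hinj : Set.InjOn (fun i => p ^ i * j % (4 * l)) (Finset.range (l - 1) : Set ℕ) := by
    intro a ha b hb hab
    simp only at hab
    have h1 := hmodl a
    rw [hab, hmodl b] at h1
    have h2 := mul_right_cancel₀ hj0 h1
    refine (pow_injOn_Iio_orderOf (x := (p : ZMod l)) ?_ ?_ h2).symm
    · rw [hord]; simpa using hb
    · rw [hord]; simpa using ha
  have hnot : l * (j % 4) ∉ (Finset.range (l - 1)).image (fun i => p ^ i * j % (4 * l)) := by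
    intro hmem
    obtain ⟨i, _, hi⟩ := Finset.mem_image.1 hmem
    have h1 := hmodl i
    rw [hi] at h1
    simp [hj0, hp0] at h1
  have hset : insert (l * (j % 4)) ((Finset.range (l - 1)).image (fun i => p ^ i * j % (4 * l)))
      = (Finset.range l).image (fun h => j % 4 + 4 * h) := by
    refine Finset.eq_of_subset_of_card_le ?_ ?_
    · intro r hr
      have hr' : r % 4 = j % 4 ∧ r < 4 * l := by
        rcases Finset.mem_insert.1 hr with rfl | hr
        · refine ⟨by rw [Nat.mul_mod, hl4]; simp, ?_⟩
          have : j % 4 < 4 := Nat.mod_lt _ (by norm_num)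
          nlinarith
        · obtain ⟨i, _, rfl⟩ := Finset.mem_image.1 hr
          exact ⟨hmod4 i, Nat.mod_lt _ (by omega)⟩
      refine Finset.mem_image.2 ⟨r / 4, ?_, ?_⟩
      · rw [Finset.mem_range]; omega
      · omega
    · rw [Finset.card_insert_of_notMem hnot, Finset.card_image_of_injOn hinj]
      refine Finset.card_image_le.trans ?_
      simp; omega
  have hsum := congrArg (fun s => ∑ x ∈ s, x) hset
  rw [Finset.sum_insert hnot, Finset.sum_image hinj, Finset.sum_image (by intro a _ b _ h; simpa using h),
    Finset.sum_add_distrib, ← Finset.mul_sum] at hsum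
  have hg := Finset.sum_range_id_mul_two l
  simp only [Finset.sum_const, Finset.card_range, smul_eq_mul] at hsum
  have : 2 * l * (l - 1) = 2 * (l * (l - 1)) := by ring
  rw [this]
  omega

lemma sum_residues {l p : ℕ} (hl : l.Prime) (hl4 : l % 4 = 1) (hp4 : p % 4 = 1)
    (hord : orderOf (p : ZMod l) = l - 1) (j : ℕ) (hj : ¬ l ∣ j) (m : ℕ) :
    ∑ i ∈ Finset.range ((l - 1) * m), (p ^ i * j % (4 * l)) = 2 * l * ((l - 1) * m) := by
  have hcop : ∀ m, ¬ l ∣ p ^ ((l - 1) * m) * j := by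
    intro m h
    rcases hl.dvd_mul.1 h with h | h
    · have h1 := hl.dvd_of_dvd_pow h
      have := Fact.mk hl
      rw [(ZMod.natCast_eq_zero_iff _ _).2 h1, orderOf_zero] at hord
      have := hl.one_lt
      omega
    · exact hj h
  induction m with
  | zero => simp
  | succ m ih =>
    rw [mul_add, mul_one, Finset.sum_range_add, ih]
    have := sum_residues_base hl hl4 hp4 hord _ (hcop m)
    rw [Finset.sum_congr rfl (g := fun i => p ^ i * (p ^ ((l - 1) * m) * j) % (4 * l)), this]
    · ring
    · intro i _
      congr 1
      ring

lemma digit_half {p : ℕ} (hp : 1 < p) (hodd : p % 2 = 1) (n : ℕ) :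
    2 * (p.digits ((p ^ n - 1) / 2)).sum = n * (p - 1) := by
  induction n with
  | zero => simp
  | succ n ih =>
    obtain ⟨c, hc⟩ : ∃ c, p ^ n = 2 * c + 1 := by
      have : p ^ n % 2 = 1 := by rw [Nat.pow_mod, hodd]; simp
      exact ⟨p ^ n / 2, by omega⟩
    obtain ⟨d, hd⟩ : ∃ d, p = 2 * d + 1 := ⟨p / 2, by omega⟩
    have h1 : (p ^ (n + 1) - 1) / 2 = d + p * c := by
      rw [pow_succ, hc]
      have : (2 * c + 1) * p = 2 * (p * c) + p := by ring
      rw [this]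
      omega
    have h2 : (p ^ n - 1) / 2 = c := by omega
    rw [h2] at ih
    rw [h1]
    have h3 : p.digits (d + p * c) = d :: p.digits c :=
      Nat.digits_add p hp d c (by omega) (Or.inl (by omega))
    rw [h3, List.sum_cons, mul_add, ih, add_mul]
    omega

lemma choose_dvd {l p m D : ℕ} (hl : l.Prime) (hp : p.Prime) (hl4 : l % 4 = 1) (hp4 : p % 4 = 1)
    (hord : orderOf (p : ZMod l) = l - 1) (hD : p ^ ((l - 1) * m) - 1 = D * (4 * l)) (hD0 : 0 < D)
    (j j' : ℕ) (hj : ¬ l ∣ j) (hj' : ¬ l ∣ j')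
    (hM : D * j + D * j' = p ^ ((l - 1) * m) * ((p ^ ((l - 1) * m) - 1) / 2)) :
    p ^ ((l - 1) * m / 2) ∣
      (p ^ ((l - 1) * m) * ((p ^ ((l - 1) * m) - 1) / 2)).choose (D * j) := by
  have := Fact.mk hp
  have hp1 := hp.one_lt
  set n := (l - 1) * m with hn
  have key : ∀ a, ¬ l ∣ a → (p - 1) * n ≤ 2 * (p.digits (D * a)).sum := by
    intro a ha
    have h1 := digit_bound (n := n) hp1 (D * a)
    rw [hD, Finset.sum_congr rfl (g := fun i => D * (p ^ i * a % (4 * l)))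
      (by intro i _; rw [← Nat.mul_mod_mul_left]; congr 1; ring), ← Finset.mul_sum,
      sum_residues hl hl4 hp4 hord a ha m, ← hn] at h1
    have : (D * (2 * l)) * ((p - 1) * n) ≤ (D * (2 * l)) * (2 * (p.digits (D * a)).sum) := by
      calc _ = (p - 1) * (D * (2 * l * n)) := by ring
        _ ≤ _ := h1
        _ = _ := by ring
    exact Nat.le_of_mul_le_mul_left this (by have := hl.pos; positivity)
  have hle : D * j ≤ p ^ n * ((p ^ n - 1) / 2) := by omega
  have hv := sub_one_mul_padicValNat_choose_eq_sub_sum_digits (p := p) hle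
  have hsub : p ^ n * ((p ^ n - 1) / 2) - D * j = D * j' := by omega
  have hsM : 2 * (p.digits (p ^ n * ((p ^ n - 1) / 2))).sum = n * (p - 1) := by
    rcases Nat.eq_zero_or_pos ((p ^ n - 1) / 2) with h0 | h0
    · rw [← digit_half hp1 (by omega), h0]; simp
    · rw [Nat.digits_base_pow_mul hp1 h0, List.sum_append, ← digit_half hp1 (by omega)]
      simp
  rw [hsub] at hv
  have h1 := key j hj
  have h2 := key j' hj'
  have h3 : (p - 1) * n ≤ (p - 1) * (2 * padicValNat p ((p ^ n * ((p ^ n - 1) / 2)).choose (D * j))) := by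
    have e : (p - 1) * (2 * padicValNat p ((p ^ n * ((p ^ n - 1) / 2)).choose (D * j)))
      = 2 * ((p - 1) * padicValNat p ((p ^ n * ((p ^ n - 1) / 2)).choose (D * j))) := by ring
    rw [e, hv]
    rw [mul_comm n] at hsM
    omega
  have h4 := Nat.le_of_mul_le_mul_left h3 (by omega)
  rw [padicValNat_dvd_iff_le]
  · omega
  · exact (Nat.choose_pos hle).ne'

end ChebAux

namespace ChebAux

lemma int_dvd_of_witt {p : ℕ} [Fact p.Prime] {F : Type*} [Field F] [CharP F p] (k : ℕ) :
    ∀ z : ℤ, ((p : WittVector p F) ^ k ∣ (z : WittVector p F)) → (p : ℤ) ^ k ∣ z := by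
  induction k with
  | zero => intro z _; simp
  | succ k ih =>
    intro z hz
    have h1 : (p : WittVector p F) ∣ (z : WittVector p F) := (dvd_pow_self _ (by omega)).trans hz
    have h2 : (p : ℤ) ∣ z := by
      obtain ⟨w, hw⟩ := h1
      have := congrArg (WittVector.constantCoeff (p := p) (R := F)) hw
      rw [map_intCast, map_mul, map_natCast, CharP.cast_eq_zero, zero_mul] at this
      exact (CharP.intCast_eq_zero_iff F p z).1 this
    obtain ⟨y, rfl⟩ := h2
    rw [pow_succ']
    refine mul_dvd_mul_left _ (ih y ?_)
    push_cast at hz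
    rw [pow_succ'] at hz
    exact (mul_dvd_mul_iff_left (WittVector.p_nonzero p F)).1 hz

/-- The Teichmüller character on units. -/
noncomputable def teich (p : ℕ) [Fact p.Prime] (F : Type*) [Field F] : Fˣ →* WittVector p F :=
  (WittVector.teichmuller p).comp (Units.coeHom F)

lemma teich_apply (p : ℕ) [Fact p.Prime] (F : Type*) [Field F] (s : Fˣ) :
    teich p F s = WittVector.teichmuller p (s : F) := rfl

lemma teich_inj (p : ℕ) [Fact p.Prime] {F : Type*} [Field F] {a b : F}
    (h : WittVector.teichmuller p a = WittVector.teichmuller p b) : a = b := by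
  have := congrArg (fun w => WittVector.coeff w 0) h
  simpa [WittVector.teichmuller_coeff_zero] using this

lemma sq_eq_one_cases {R : Type*} [CommRing R] [IsDomain R] {x : R} (h : x ^ 2 = 1) :
    x = 1 ∨ x = -1 := by
  have : (x - 1) * (x + 1) = 0 := by linear_combination h
  rcases mul_eq_zero.1 this with h | h
  · left; linear_combination h
  · right; linear_combination h

lemma teich_quad {p : ℕ} [hp : Fact p.Prime] {F : Type*} [Field F] [Fintype F] [DecidableEq F]
    [CharP F p] (hp2 : p ≠ 2) (a : F) :
    ((quadraticChar F a : ℤ) : WittVector p F) =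
      WittVector.teichmuller p a ^ (Fintype.card F / 2) := by
  have hrc : ringChar F ≠ 2 := by rwa [ringChar.eq F p]
  have hc := quadraticChar_eq_pow_of_char_ne_two' hrc a
  have hcard : Fintype.card F / 2 ≠ 0 := by
    have := Fintype.one_lt_card (α := F)
    omega
  rw [← map_pow, ← hc]
  by_cases ha : a = 0
  · subst ha
    simp
  · rcases quadraticChar_dichotomy ha with h | h
    · rw [h]; simp
    · rw [h]
      have h1 : WittVector.teichmuller p (((-1 : ℤ)) : F) ^ 2 = 1 := by
        rw [← map_pow]; simp
      rcases sq_eq_one_cases h1 with h2 | h2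
      · exfalso
        rw [← map_one (WittVector.teichmuller p)] at h2
        have h3 := teich_inj p h2
        have h4 := Ring.neg_one_ne_one_of_char_ne_two hrc
        exact h4 (by simpa using h3)
      · rw [h2]; simp

lemma exponent_solve {l q D j M : ℕ} (hl : l.Prime) (hl4 : l % 4 = 1) (hD : q - 1 = D * (4 * l))
    (hD0 : 0 < D) (hM : M = q * ((q - 1) / 2)) (hj : j ≤ M) (h : 4 * D + j ≡ M - j [MOD q - 1]) :
    ∃ a b, j = D * a ∧ ¬ l ∣ a ∧ ¬ l ∣ b ∧ D * a + D * b = M := by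
  have hl1 := hl.one_lt
  have hq : q = D * (4 * l) + 1 := by
    have : 0 < D * (4 * l) := by positivity
    omega
  have hM2 : M = q * (D * (2 * l)) := by
    rw [hM, hD]
    congr 1
    have : D * (4 * l) = 2 * (D * (2 * l)) := by ring
    omega
  obtain ⟨k, hk⟩ := (Nat.modEq_iff_dvd.1 h)
  push_cast [Nat.cast_sub hj] at hk
  have hqz : (q : ℤ) = D * (4 * l) + 1 := by exact_mod_cast hq
  have hq1 : ((q - 1 : ℕ) : ℤ) = D * (4 * l) := by rw [hD]; push_cast; ring
  rw [hq1] at hk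
  have hMz : (M : ℤ) = (D * (4 * l) + 1) * (D * (2 * l)) := by rw [hM2]; push_cast; rw [hqz]
  have hjz : (j : ℤ) = D * (l * (4 * D * l + 1 - 2 * k) - 2) := by
    rw [hMz] at hk
    have : (2 : ℤ) * j = 2 * (D * (l * (4 * D * l + 1 - 2 * k) - 2)) := by linear_combination -hk
    exact mul_left_cancel₀ two_ne_zero this
  have hdj : D ∣ j := by exact_mod_cast (Dvd.intro _ hjz.symm : (D : ℤ) ∣ j)
  obtain ⟨a, ha⟩ := hdj
  have hDz : (D : ℤ) ≠ 0 := by exact_mod_cast hD0.ne'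
  have haz : (a : ℤ) = l * (4 * D * l + 1 - 2 * k) - 2 := by
    rw [ha] at hjz
    push_cast at hjz
    exact mul_left_cancel₀ hDz hjz
  have hl2 : ¬ (l : ℤ) ∣ 2 := by
    intro h2
    have : l ∣ 2 := by exact_mod_cast h2
    have := Nat.le_of_dvd (by norm_num) this
    omega
  have hna : ¬ l ∣ a := by
    intro hda
    have h1 : (l : ℤ) ∣ a := by exact_mod_cast hda
    apply hl2
    have : (2 : ℤ) = l * (4 * D * l + 1 - 2 * k) - a := by linarith
    rw [this]
    exact dvd_sub (dvd_mul_right _ _) h1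
  have hle : a ≤ q * (2 * l) := by
    have : D * a ≤ D * (q * (2 * l)) := by
      rw [← ha]
      calc j ≤ M := hj
        _ = _ := by rw [hM2]; ring
    exact Nat.le_of_mul_le_mul_left this hD0
  refine ⟨a, q * (2 * l) - a, ha, hna, ?_, ?_⟩
  · intro hb
    apply hna
    have h1 : l ∣ q * (2 * l) := ⟨q * 2, by ring⟩
    exact (Nat.dvd_sub_iff_right hle h1).1 hb
  · rw [← mul_add, Nat.add_sub_cancel' hle, hM2]; ring

lemma witt_dvd {l p m D : ℕ} (hl : l.Prime) [hp : Fact p.Prime] (hl4 : l % 4 = 1) (hp4 : p % 4 = 1)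
    (hord : orderOf (p : ZMod l) = l - 1) (hD : p ^ ((l - 1) * m) - 1 = D * (4 * l)) (hD0 : 0 < D)
    (F : Type*) [Field F] [Fintype F] [DecidableEq F] [CharP F p]
    (hF : Fintype.card F = p ^ ((l - 1) * m)) :
    ∃ ψ : Fˣ →* WittVector p F, ψ ≠ 1 ∧ (∀ s, ψ s ^ l = 1) ∧
      (p : WittVector p F) ^ ((l - 1) * m / 2) ∣
        ∑ s : Fˣ, ψ s * ((quadraticChar F ((s : F) + (s⁻¹ : Fˣ)) : ℤ) : WittVector p F) := by
  have hl1 := hl.one_lt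
  set n := (l - 1) * m with hn
  obtain ⟨g, hg⟩ := IsCyclic.exists_generator (α := Fˣ)
  have hog : orderOf g = p ^ n - 1 := by
    rw [orderOf_eq_card_of_forall_mem_zpowers hg, Nat.card_eq_fintype_card, Fintype.card_units, hF]
  have hT : ∀ a b : Fˣ, teich p F a = teich p F b → a = b := fun a b h =>
    Units.ext (teich_inj p h)
  refine ⟨teich p F ^ (4 * D), ?_, ?_, ?_⟩
  · intro h
    have h1 := DFunLike.congr_fun h g
    rw [MonoidHom.pow_apply, ← map_pow, MonoidHom.one_apply, ← map_one (teich p F)] at h1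
    have h2 := orderOf_dvd_of_pow_eq_one (hT _ _ h1)
    rw [hog, hD] at h2
    have := Nat.le_of_dvd (by positivity) h2
    nlinarith
  · intro s
    rw [MonoidHom.pow_apply, ← pow_mul, ← map_pow]
    have : s ^ (4 * D * l) = 1 := by
      rw [show 4 * D * l = Fintype.card Fˣ by rw [Fintype.card_units, hF, hD]; ring]
      exact pow_card_eq_one
    rw [this, map_one]
  · set M := p ^ n * ((p ^ n - 1) / 2) with hM
    have hodd : p ^ n % 2 = 1 := by rw [Nat.pow_mod, show p % 2 = 1 by omega]; simp
    have hcong : ∀ s : Fˣ, (p : WittVector p F) ^ (n / 2) ∣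
        ((quadraticChar F ((s : F) + (s⁻¹ : Fˣ)) : ℤ) : WittVector p F) -
          (teich p F s + teich p F s⁻¹) ^ M := by
      intro s
      rw [teich_quad (by rintro rfl; omega)]
      set x := (s : F) + (s⁻¹ : Fˣ) with hx
      have h1 : (p : WittVector p F) ∣
          WittVector.teichmuller p x - (teich p F s + teich p F s⁻¹) := by
        rw [← Ideal.mem_span_singleton, WittVector.mem_span_p_iff_coeff_zero_eq_zero]
        change WittVector.constantCoeff (p := p) (R := F)
          (WittVector.teichmuller p x - (teich p F s + teich p F s⁻¹)) = 0
        rw [map_sub WittVector.constantCoeff, map_add WittVector.constantCoeff (teich p F s)]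
        change (WittVector.teichmuller p x).coeff 0 - ((WittVector.teichmuller p (s : F)).coeff 0 +
          (WittVector.teichmuller p ((s⁻¹ : Fˣ) : F)).coeff 0) = 0
        simp only [WittVector.teichmuller_coeff_zero, hx, sub_self]
      have h2 := dvd_sub_pow_of_dvd_sub h1 n
      have h3 : WittVector.teichmuller p x ^ p ^ n = WittVector.teichmuller p x := by
        rw [← map_pow, ← hF, FiniteField.pow_card]
      rw [h3] at h2
      have h4 := h2.trans (sub_dvd_pow_sub_pow _ _ ((p ^ n - 1) / 2))
      rw [← pow_mul, ← hM] at h4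
      rw [hF, show p ^ n / 2 = (p ^ n - 1) / 2 by omega]
      exact (pow_dvd_pow _ (by omega)).trans h4
    have hmain : (p : WittVector p F) ^ (n / 2) ∣
        ∑ s : Fˣ, (teich p F ^ (4 * D)) s * (teich p F s + teich p F s⁻¹) ^ M := by
      simp_rw [add_pow, Finset.mul_sum]
      rw [Finset.sum_comm]
      refine Finset.dvd_sum fun j hj => ?_
      have hjM : j ≤ M := by have := Finset.mem_range.1 hj; omega
      let φ : Fˣ →* WittVector p F := teich p F ^ (4 * D) * (teich p F ^ j *
        (teich p F).comp (invMonoidHom) ^ (M - j))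
      have e : ∀ s : Fˣ, (teich p F ^ (4 * D)) s * (teich p F s ^ j * teich p F s⁻¹ ^ (M - j) *
          (M.choose j : WittVector p F)) = φ s * (M.choose j : WittVector p F) := by
        intro s
        simp only [φ, MonoidHom.mul_apply, MonoidHom.pow_apply, MonoidHom.comp_apply,
          invMonoidHom_apply]
        ring
      simp_rw [e]
      rw [← Finset.sum_mul]
      by_cases hφ : φ = 1
      · have h1 := DFunLike.congr_fun hφ g
        simp only [φ, MonoidHom.mul_apply, MonoidHom.pow_apply, MonoidHom.comp_apply,
          invMonoidHom_apply, MonoidHom.one_apply, ← map_pow, ← map_mul] at h1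
        rw [← map_one (teich p F)] at h1
        have h2 := hT _ _ h1
        rw [inv_pow, ← mul_assoc, mul_inv_eq_one, ← pow_add, pow_eq_pow_iff_modEq, hog] at h2
        obtain ⟨a, b, hja, ha, hb, hab⟩ := exponent_solve hl hl4 hD hD0 hM hjM h2
        have := choose_dvd (m := m) hl hp.out hl4 hp4 hord hD hD0 a b ha hb hab
        rw [hja]
        refine dvd_mul_of_dvd_right ?_ _
        exact_mod_cast (Nat.cast_dvd_cast (α := WittVector p F) this)
      · rw [sum_hom_units_eq_zero φ hφ, zero_mul]
        exact dvd_zero _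
    have := dvd_add (Finset.dvd_sum (s := Finset.univ) fun s _ =>
      Dvd.dvd.mul_left (hcong s) ((teich p F ^ (4 * D)) s)) hmain
    rw [← Finset.sum_add_distrib] at this
    have e2 : ∀ s : Fˣ, (teich p F ^ (4 * D)) s *
        ((quadraticChar F ((s : F) + (s⁻¹ : Fˣ)) : ℤ) : WittVector p F) =
        (teich p F ^ (4 * D)) s * (((quadraticChar F ((s : F) + (s⁻¹ : Fˣ)) : ℤ) : WittVector p F) -
          (teich p F s + teich p F s⁻¹) ^ M) +
        (teich p F ^ (4 * D)) s * (teich p F s + teich p F s⁻¹) ^ M := by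
      intro s
      rw [← mul_add, sub_add_cancel]
    rw [Finset.sum_congr rfl fun s _ => e2 s]
    exact this

end ChebAux

namespace ChebAux

lemma sum_units_eq {F : Type*} [Field F] [Fintype F] [DecidableEq F] {R : Type*} [AddCommMonoid R]
    (g : F → R) (h0 : g 0 = 0) : ∑ s : Fˣ, g s = ∑ x : F, g x := by
  classical
  rw [← Finset.sum_filter_of_ne (s := Finset.univ) (p := fun x : F => x ≠ 0)
    (by intro x _ hx h; exact hx (by rw [h, h0]))]
  refine Finset.sum_bij (fun s _ => (s : F)) ?_ ?_ ?_ ?_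
  · intro s _; simp
  · intro a _ b _ h; exact Units.ext h
  · intro b hb
    have hb0 : b ≠ 0 := by simpa using hb
    exact ⟨Units.mk0 b hb0, Finset.mem_univ _, rfl⟩
  · intro a _; rfl

lemma sum_sq_eq {F : Type*} [Field F] [Fintype F] [DecidableEq F] (hF : ringChar F ≠ 2)
    {R : Type*} [CommRing R] (g : F → R) :
    ∑ x : F, g (x ^ 2) = ∑ u : F, (1 + ((quadraticChar F u : ℤ) : R)) * g u := by
  classical
  rw [← Finset.sum_fiberwise Finset.univ (fun t : F => t ^ 2)]
  refine Finset.sum_congr rfl fun s _ => ?_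
  rw [Finset.sum_congr rfl (g := fun _ => g s)]
  · have := quadraticChar_card_sqrts hF s
    rw [Finset.sum_const, nsmul_eq_mul]
    congr 1
    have e : ({x : F | x ^ 2 = s}.toFinset) = Finset.univ.filter (fun t : F => t ^ 2 = s) := by
      ext; simp
    rw [e] at this
    have h2 := congrArg (Int.cast : ℤ → R) this
    push_cast at h2
    rw [h2, add_comm]
  · intro x hx
    rw [(Finset.mem_filter.1 hx).2]

lemma int_dvd_of_integral {N d : ℤ} (hd : d ≠ 0) {u : ℂ} (hu : IsIntegral ℤ u)
    (h : (N : ℂ) = d * u) : ∃ k : ℤ, N = d * k ∧ u = k := by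
  have h1 : u = algebraMap ℚ ℂ ((N : ℚ) / d) := by
    have : (d : ℂ) ≠ 0 := by exact_mod_cast hd
    simp only [map_div₀, map_intCast]
    field_simp
    rw [h]; ring
  rw [h1] at hu
  have h2 : IsIntegral ℤ ((N : ℚ) / d) :=
    (isIntegral_algebraMap_iff (algebraMap ℚ ℂ).injective).1 hu
  obtain ⟨k, hk⟩ := IsIntegrallyClosed.isIntegral_iff.1 h2
  refine ⟨k, ?_, ?_⟩
  · have hd' : (d : ℚ) ≠ 0 := by exact_mod_cast hd
    rw [eq_div_iff hd'] at hk
    have : (N : ℚ) = d * k := by rw [← hk]; simp [mul_comm]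
    exact_mod_cast this
  · rw [h1, ← hk]; simp

lemma isIntegral_of_pow {z : ℂ} {n : ℕ} (hn : 0 < n) (h : z ^ n = 1) : IsIntegral ℤ z :=
  IsIntegral.of_pow hn (by rw [h]; exact isIntegral_one)

lemma isIntegral_I : IsIntegral ℤ Complex.I :=
  isIntegral_of_pow (n := 4) (by norm_num) Complex.I_pow_four

lemma quarter {z : ℂ} (h : z ^ 4 = 1) :
    ∃ c : ℂ, IsIntegral ℤ c ∧ 1 + z = (1 + Complex.I) * c := by
  have hI := Complex.I_sq
  have : (z - 1) * (z + 1) * (z - Complex.I) * (z + Complex.I) = 0 := by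
    linear_combination h - (z ^ 2 - 1) * hI
  simp only [mul_eq_zero] at this
  rcases this with ((h | h) | h) | h
  · exact ⟨1 - Complex.I, isIntegral_one.sub isIntegral_I, by linear_combination h + hI⟩
  · exact ⟨0, isIntegral_zero, by linear_combination h⟩
  · exact ⟨1, isIntegral_one, by linear_combination h⟩
  · exact ⟨-Complex.I, isIntegral_I.neg, by linear_combination h + hI⟩

lemma isIntegral_mulChar {F : Type*} [Field F] [Fintype F] [DecidableEq F] (χ : MulChar F ℂ) (x : F) :
    IsIntegral ℤ (χ x) := by
  by_cases hx : x = 0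
  · subst hx; rw [MulChar.map_zero]; exact isIntegral_zero
  · refine isIntegral_of_pow (n := Fintype.card Fˣ) Fintype.card_pos ?_
    have h1 : (Units.mk0 x hx) ^ Fintype.card Fˣ = 1 := pow_card_eq_one
    have h2 : x ^ Fintype.card Fˣ = 1 := by
      have := congrArg (Units.val) h1
      rw [Units.val_pow_eq_pow_val] at this
      exact this
    rw [← map_pow, h2, map_one]

lemma isIntegral_conj {z : ℂ} (h : IsIntegral ℤ z) : IsIntegral ℤ ((starRingEnd ℂ) z) :=
  h.map (starRingEnd ℂ).toIntAlgHom

/-- the complex valued quadratic character -/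
noncomputable def qc (F : Type*) [Field F] [Fintype F] [DecidableEq F] : MulChar F ℂ :=
  (quadraticChar F).ringHomComp (Int.castRingHom ℂ)

section

variable {F : Type*} [Field F] [Fintype F] [DecidableEq F]

lemma qc_apply (x : F) : qc F x = ((quadraticChar F x : ℤ) : ℂ) := rfl

lemma qc_isQuadratic : (qc F).IsQuadratic := (quadraticChar_isQuadratic F).comp _

lemma qc_sq : (qc F) ^ 2 = 1 := qc_isQuadratic.sq_eq_one

lemma qc_inv : (qc F)⁻¹ = qc F := qc_isQuadratic.inv

lemma qc_ne_one (hF : ringChar F ≠ 2) : qc F ≠ 1 := by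
  intro h
  apply quadraticChar_ne_one hF
  ext a
  have := DFunLike.congr_fun h (a : F)
  rw [qc_apply] at this
  have h2 : (1 : MulChar F ℂ) (a : F) = 1 := MulChar.one_apply_coe a
  have h3 : (1 : MulChar F ℤ) (a : F) = 1 := MulChar.one_apply_coe a
  rw [h2] at this
  rw [h3]
  exact_mod_cast this

lemma quad_pow_odd {p : ℕ} (hp : Odd p) (x : F) : quadraticChar F (x ^ p) = quadraticChar F x := by
  rw [map_pow]
  by_cases hx : x = 0
  · subst hx
    rw [MulChar.map_zero, zero_pow (by rintro rfl; simp at hp)]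
  · rcases quadraticChar_dichotomy hx with h | h <;> rw [h]
    · simp
    · exact hp.neg_one_pow

lemma conj_jacobi (ρ : MulChar F ℂ) :
    (starRingEnd ℂ) (jacobiSum ρ (qc F)) = jacobiSum ρ⁻¹ (qc F) := by
  rw [jacobiSum, map_sum, jacobiSum]
  refine Finset.sum_congr rfl fun x _ => ?_
  rw [map_mul]
  congr 1
  · exact MulChar.star_apply' ρ x
  · rw [qc_apply]; simp

lemma frob_jacobi {p : ℕ} [Fact p.Prime] [CharP F p] (hp : Odd p) (ρ : MulChar F ℂ) (i : ℕ) :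
    jacobiSum (ρ ^ (p ^ i)) (qc F) = jacobiSum ρ (qc F) := by
  have hp0 : p ≠ 0 := by rintro rfl; simp at hp
  induction i with
  | zero => simp
  | succ i ih =>
    rw [← ih, jacobiSum, jacobiSum, ← Equiv.sum_comp (frobeniusEquiv F p).toEquiv
      (fun x => (ρ ^ (p ^ i)) x * qc F (1 - x))]
    refine Finset.sum_congr rfl fun x _ => ?_
    have e : (frobeniusEquiv F p).toEquiv x = x ^ p := rfl
    rw [e]
    congr 1
    · rw [MulChar.pow_apply' _ (by positivity), MulChar.pow_apply' _ (by positivity), map_pow,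
        ← pow_mul, pow_succ']
    · rw [qc_apply, qc_apply, ← quad_pow_odd hp (1 - x), sub_pow_char, one_pow]

end

end ChebAux

namespace ChebAux

set_option linter.unusedSectionVars false

section

variable {F : Type*} [Field F] [Fintype F] [DecidableEq F]

lemma qc_eq_one_of_ne {x : F} (hx : x ≠ 0) : qc F x = 1 ∨ qc F x = -1 := by
  rcases quadraticChar_dichotomy hx with h | h <;> simp [qc_apply, h]

lemma eq_qc_of_order_two (σ : MulChar F ℂ) (h2 : σ ^ 2 = 1) (h1 : σ ≠ 1) : σ = qc F := by
  have hsq : ∀ x : F, x ≠ 0 → quadraticChar F x = 1 → σ x = 1 := by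
    intro x hx h
    obtain ⟨y, hy⟩ := (quadraticChar_one_iff_isSquare hx).1 h
    have hy0 : y ≠ 0 := by rintro rfl; simp at hy; exact hx hy
    have : (σ ^ 2) y = 1 := by rw [h2]; exact MulChar.one_apply (isUnit_iff_ne_zero.2 hy0)
    rw [MulChar.pow_apply' _ (by norm_num)] at this
    rw [hy, map_mul, ← sq, this]
  have hpm : ∀ x : F, x ≠ 0 → σ x = 1 ∨ σ x = -1 := by
    intro x hx
    have : (σ ^ 2) x = 1 := by rw [h2]; exact MulChar.one_apply (isUnit_iff_ne_zero.2 hx)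
    rw [MulChar.pow_apply' _ (by norm_num)] at this
    exact sq_eq_one_iff.1 this
  obtain ⟨a, ha⟩ := MulChar.ne_one_iff.1 h1
  have ha0 : (a : F) ≠ 0 := a.ne_zero
  have hσa : σ a = -1 := (hpm _ ha0).resolve_left ha
  have hqa : quadraticChar F (a : F) = -1 :=
    (quadraticChar_dichotomy ha0).resolve_left fun h => ha (hsq _ ha0 h)
  ext x
  have hx0 : (x : F) ≠ 0 := x.ne_zero
  rw [qc_apply]
  rcases quadraticChar_dichotomy hx0 with h | h
  · rw [h, hsq _ hx0 h]; simp
  · have h3 : σ ((x : F) * a) = 1 := by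
      apply hsq _ (mul_ne_zero hx0 ha0)
      rw [map_mul, h, hqa]; norm_num
    rw [map_mul, hσa] at h3
    rw [h]
    push_cast
    linear_combination -h3

lemma exists_tau (h8 : Fintype.card F % 8 = 1) : ∃ τ : MulChar F ℂ, τ ^ 2 = qc F := by
  obtain ⟨τ, hτ⟩ := MulChar.exists_mulChar_orderOf (n := 4) F (by omega)
    (Complex.isPrimitiveRoot_exp 4 (by norm_num))
  refine ⟨τ, eq_qc_of_order_two _ ?_ ?_⟩
  · rw [← pow_mul]; norm_num; rw [← hτ]; exact pow_orderOf_eq_one τ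
  · exact pow_ne_one_of_lt_orderOf (by norm_num) (by rw [hτ]; norm_num)

lemma exists_psi {l : ℕ} (hl : l.Prime) (h : l ∣ Fintype.card F - 1) :
    ∃ ψ : MulChar F ℂ, ψ ≠ 1 ∧ ψ ^ l = 1 := by
  obtain ⟨τ, hτ⟩ := MulChar.exists_mulChar_orderOf (n := l) F h
    (Complex.isPrimitiveRoot_exp l hl.ne_zero)
  refine ⟨τ, ?_, ?_⟩
  · rintro rfl; rw [orderOf_one] at hτ; exact hl.one_lt.ne hτ
  · rw [← hτ]; exact pow_orderOf_eq_one τ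

lemma pow_ne_one_of_prime {G : Type*} [Group G] {l : ℕ} (hl : l.Prime) {ψ : G} (h1 : ψ ≠ 1)
    (h2 : ψ ^ l = 1) {k : ℕ} (hk : ¬ l ∣ k) : ψ ^ k ≠ 1 := by
  intro h
  have := orderOf_eq_prime h2 h1 (hp := ⟨hl⟩)
  exact hk (this ▸ orderOf_dvd_of_pow_eq_one h)

lemma pow_eq_of_modEq {G : Type*} [Group G] {l : ℕ} {ψ : G}
    (h2 : ψ ^ l = 1) {a b : ℕ} (h : a ≡ b [MOD l]) : ψ ^ a = ψ ^ b :=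
  pow_eq_pow_iff_modEq.2 (h.of_dvd (orderOf_dvd_of_pow_eq_one h2))

lemma jac_norm (hF : ringChar F ≠ 2) (ρ : MulChar F ℂ) (h : ρ ^ 4 ≠ 1) :
    jacobiSum ρ (qc F) * (starRingEnd ℂ) (jacobiSum ρ (qc F)) = Fintype.card F := by
  rw [conj_jacobi]
  conv_lhs => enter [2, 2]; rw [← qc_inv]
  refine jacobiSum_mul_jacobiSum_inv ?_ ?_ (qc_ne_one hF) ?_
  · rw [ringChar.eq_zero]
    exact (CharP.ringChar_ne_zero_of_finite F).symm
  · rintro rfl; simp at h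
  · intro h1
    apply h
    have := congrArg (· ^ 4) h1
    simp only [mul_pow, one_pow] at this
    rwa [show (4 : ℕ) = 2 * 2 from rfl, pow_mul (qc F), qc_sq, one_pow, mul_one] at this

lemma neg_one_val (h8 : Fintype.card F % 8 = 1) (hF : ringChar F ≠ 2) (τ : MulChar F ℂ)
    (hτ : τ ^ 2 = qc F) : τ (-1) = 1 := by
  obtain ⟨i, hi⟩ : IsSquare (-1 : F) := by
    rw [FiniteField.isSquare_neg_one_iff]; omega
  have hi0 : i ≠ 0 := by rintro rfl; simp at hi
  have h1 : IsSquare i := by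
    rw [FiniteField.isSquare_iff hF hi0]
    obtain ⟨k, hk⟩ : ∃ k, Fintype.card F / 2 = 4 * k := ⟨Fintype.card F / 8, by omega⟩
    rw [hk, pow_mul, show i ^ 4 = (i * i) ^ 2 by ring, ← hi]; simp
  have h2 : quadraticChar F i = 1 := (quadraticChar_one_iff_isSquare hi0).2 h1
  rw [hi, map_mul, ← sq, ← MulChar.pow_apply' _ (by norm_num), hτ, qc_apply, h2]; simp

lemma odd_neg_one_val {l : ℕ} (hl : Odd l) (ψ : MulChar F ℂ) (h : ψ ^ l = 1) : ψ (-1) = 1 := by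
  have h1 : (ψ ^ l) (-1) = 1 := by rw [h]; exact MulChar.one_apply isUnit_one.neg
  have h0 : l ≠ 0 := by rintro rfl; simp at hl
  rwa [MulChar.pow_apply' _ h0, ← map_pow, hl.neg_one_pow] at h1

lemma sum_f_eq (h8 : Fintype.card F % 8 = 1) (hF : ringChar F ≠ 2) (τ ψ : MulChar F ℂ)
    (hτ : τ ^ 2 = qc F) (hψ : ψ (-1) = 1) :
    ∑ s : Fˣ, (ψ s) ^ 2 * qc F ((s : F) + (s⁻¹ : Fˣ)) =
      jacobiSum (τ * ψ) (qc F) + jacobiSum (τ⁻¹ * ψ) (qc F) := by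
  have hτ' : ∀ x : F, qc F x = τ x * τ x := by
    intro x; rw [← hτ, MulChar.pow_apply' _ (by norm_num), sq]
  have h1 : ∀ s : Fˣ, (ψ s) ^ 2 * qc F ((s : F) + (s⁻¹ : Fˣ)) =
      (fun x : F => (τ * ψ) (x ^ 2) * qc F (x ^ 2 + 1)) s := by
    intro s
    have e : (s : F) + (s⁻¹ : Fˣ) = (s⁻¹ : Fˣ) * ((s : F) ^ 2 + 1) := by
      rw [mul_add, sq, Units.inv_mul_cancel_left, mul_one]
    have e2 : qc F ((s⁻¹ : Fˣ) : F) = qc F (s : F) := by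
      rw [Units.val_inv_eq_inv_val, ← MulChar.inv_apply', qc_inv]
    simp only [MulChar.mul_apply, map_pow]
    rw [e, map_mul, e2, hτ' s]; ring
  simp only [h1]
  rw [sum_units_eq (fun x : F => (τ * ψ) (x ^ 2) * qc F (x ^ 2 + 1))
      (by simp [MulChar.map_zero]),
    sum_sq_eq hF (fun x => (τ * ψ) x * qc F (x + 1)), ← Equiv.sum_comp (Equiv.neg F), jacobiSum,
    jacobiSum, ← Finset.sum_add_distrib]
  refine Finset.sum_congr rfl fun x _ => ?_
  have hn : ∀ ρ : MulChar F ℂ, ρ (-1) = 1 → ρ (-x) = ρ x := fun ρ h => by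
    rw [neg_eq_neg_one_mul, map_mul, h, one_mul]
  have ht := neg_one_val h8 hF τ hτ
  have hq : qc F (-1) = 1 := by rw [hτ', ht, one_mul]
  simp only [Equiv.neg_apply, ← qc_apply, MulChar.mul_apply]
  rw [hn _ hψ, hn _ ht, hn _ hq, show -x + 1 = 1 - x by ring]
  have e3 : qc F x * τ x = τ⁻¹ x := by
    have : qc F * τ = τ⁻¹ := by
      rw [eq_comm, inv_eq_iff_mul_eq_one, ← hτ]
      have := qc_sq (F := F)
      rw [← hτ] at this
      rw [← this]; 
      rw [← pow_succ, ← pow_succ', ← pow_mul]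
    rw [← this, MulChar.mul_apply]
  rw [← e3]; ring

end

end ChebAux

namespace ChebAux

set_option linter.unusedSectionVars false

lemma pow_four_mod (p k : ℕ) (hp : p % 4 = 1) : p ^ (4 * k) % 16 = 1 := by
  rw [pow_mul, Nat.pow_mod]
  have : p ^ 4 % 16 = 1 := by
    rw [Nat.pow_mod]
    have : p % 16 = 1 ∨ p % 16 = 5 ∨ p % 16 = 9 ∨ p % 16 = 13 := by omega
    rcases this with h | h | h | h <;> rw [h]
  rw [this]; simp

lemma pow_mod_four (p k : ℕ) (hp : p % 4 = 1) : p ^ k % 4 = 1 := by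
  rw [Nat.pow_mod, hp]; simp

section

variable {F : Type*} [Field F] [Fintype F] [DecidableEq F]

lemma frob_psi {l p : ℕ} [Fact p.Prime] [CharP F p] (hl : l.Prime) (hp4 : p % 4 = 1)
    (hgen : ∀ k, ¬ l ∣ k → ∃ i, p ^ i ≡ k [MOD l]) (τ ψ : MulChar F ℂ) (hτ : τ ^ 4 = 1)
    (hψ : ψ ^ l = 1) :
    jacobiSum (τ⁻¹ * ψ) (qc F) = (starRingEnd ℂ) (jacobiSum (τ * ψ) (qc F)) := by
  obtain ⟨i, hi⟩ := hgen (l - 1) (by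
    intro h
    have := hl.two_le
    have := Nat.le_of_dvd (by omega) h
    omega)
  rw [conj_jacobi, ← frob_jacobi (p := p) (Nat.odd_iff.2 (by omega)) _ i, mul_pow]
  congr 1
  rw [pow_eq_of_modEq hψ hi, pow_eq_of_modEq (l := 4) (ψ := τ⁻¹) (a := p ^ i) (b := 1)
    (by rw [inv_pow, hτ, inv_one]) (pow_mod_four p i hp4), mul_inv, pow_one]
  congr 1
  rw [eq_inv_iff_mul_eq_one, ← pow_succ, Nat.sub_add_cancel hl.one_lt.le, hψ]

lemma char_two_ne {p : ℕ} [CharP F p] (hp4 : p % 4 = 1) : ringChar F ≠ 2 := by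
  rw [ringChar.eq F p]; omega

lemma half_pow {l p : ℕ} (hl : l.Prime) (hl4 : l % 4 = 1)
    (hord : orderOf (p : ZMod l) = l - 1) : ((p : ZMod l)) ^ ((l - 1) / 2) = -1 := by
  have : Fact l.Prime := ⟨hl⟩
  have hl2 := hl.two_le
  have h1 : ((p : ZMod l) ^ ((l - 1) / 2)) ^ 2 = 1 := by
    rw [← pow_mul, show (l - 1) / 2 * 2 = l - 1 by omega, ← hord, pow_orderOf_eq_one]
  refine (sq_eq_one_iff.1 h1).resolve_left ?_
  apply pow_ne_one_of_lt_orderOf <;> omega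

lemma a_val {l p m : ℕ} [Fact p.Prime] [CharP F p] (hl : l.Prime) (hl4 : l % 4 = 1)
    (hp4 : p % 4 = 1) (hgen : ∀ k, ¬ l ∣ k → ∃ i, p ^ i ≡ k [MOD l])
    (hord : orderOf (p : ZMod l) = l - 1) (hF : Fintype.card F = p ^ ((l - 1) * m))
    (hd : l ∣ Fintype.card Fˣ) (hcop : (Fintype.card Fˣ).Coprime p)
    (ψ : MulChar F ℂ) (hψ1 : ψ ≠ 1) (hψ : ψ ^ l = 1) :
    jacobiSum ψ (qc F) = ((-(-1) ^ m * (p : ℤ) ^ ((l - 1) / 2 * m) : ℤ) : ℂ) := by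
  have hl2 := hl.two_le
  have hodd : Odd p := Nat.odd_iff.2 (by omega)
  have hF2 := char_two_ne (F := F) (p := p) hp4
  set a := jacobiSum ψ (qc F) with ha
  have hr : (starRingEnd ℂ) a = a := by
    have := frob_psi hl hp4 hgen 1 ψ (one_pow 4) hψ
    rw [inv_one, one_mul] at this
    exact this.symm
  have h4 : ψ ^ 4 ≠ 1 := pow_ne_one_of_prime hl hψ1 hψ (by
    intro h
    have := Nat.le_of_dvd (by norm_num) h
    interval_cases l <;> omega)
  have hn := jac_norm hF2 ψ h4
  rw [← ha, hr, hF, show (l - 1) * m = ((l - 1) / 2 * m) * 2 by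
    rw [mul_right_comm]; congr 1; omega, pow_mul] at hn
  set P := p ^ ((l - 1) / 2 * m) with hP
  have hcases : a = P ∨ a = -P := by
    apply sq_eq_sq_iff_eq_or_eq_neg.1
    rw [sq, hn]; push_cast; rfl
  -- the master identity
  let Ψ : Fˣ →* ℂ := (Units.coeHom ℂ).comp ψ.toUnitHom
  have hΨ : ∀ s, Ψ s = ψ s := fun s => MulChar.coe_toUnitHom ψ s
  have hm := master (G := Fˣ) (R := ℂ) hl hcop hgen hd Ψ (by
    intro h
    apply hψ1
    ext s
    rw [← hΨ, h, MulChar.one_apply_coe]; rfl) (by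
    intro s
    rw [hΨ, ← MulChar.pow_apply_coe, hψ, MulChar.one_apply_coe])
    (fun s => qc F (1 - s)) (by
      intro s
      rw [Units.val_pow_eq_pow_val, qc_apply, qc_apply, ← quad_pow_odd hodd (1 - (s : F)), sub_pow_char, one_pow])
  have e1 : ∑ s : Fˣ, Ψ s * qc F (1 - s) = a := by
    simp only [hΨ]
    rw [sum_units_eq (fun x : F => ψ x * qc F (1 - x)) (by simp [MulChar.map_zero])]
    rfl
  have e2 : ∑ s : Fˣ, qc F (1 - s) = -1 := by
    have h1 : ∑ x : F, qc F (1 - x) = 0 := by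
      rw [← MulChar.sum_eq_zero_of_ne_one (qc_ne_one hF2)]
      exact Equiv.sum_comp (Equiv.subLeft (1 : F)) (fun x => qc F x)
    have h2 := sum_units_eq (fun x : F => qc F (1 - x) - if x = 0 then 1 else 0) (by simp)
    rw [Finset.sum_sub_distrib, Finset.sum_sub_distrib, h1] at h2
    simpa using h2
  obtain ⟨c, hc⟩ := dvd_sum_pow (G := Fˣ) hd (fun s => quadraticChar F (1 - s))
  have e3 : ∑ t : Fˣ, qc F (1 - ((t ^ l : Fˣ) : F)) = ((l * c : ℤ) : ℂ) := by
    rw [← hc]; push_cast; rfl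
  rw [e1, e2, e3] at hm
  have hPl : ((P : ℤ) : ZMod l) = (-1) ^ m := by
    rw [hP]; push_cast; rw [pow_mul, half_pow hl hl4 hord]
  have key : ∀ e : ℤ, (e = 1 ∨ e = -1) → a = ((e * P : ℤ) : ℂ) → e = -(-1) ^ m := by
    intro e he hae
    rw [hae] at hm
    have h1 : (l * c : ℤ) - -1 = ((l : ℤ) - 1) * (e * P) := by exact_mod_cast hm
    have h2 := congrArg (Int.cast : ℤ → ZMod l) h1
    push_cast at h2 hPl
    rw [ZMod.natCast_self, hPl] at h2
    have h3 : ((e : ZMod l)) * (-1) ^ m = -1 := by linear_combination h2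
    have hne : (1 : ZMod l) ≠ -1 := by
      have : Fact (2 < l) := ⟨by
        rcases Nat.lt_or_ge 2 l with h | h
        · exact h
        · interval_cases l; omega⟩
      exact (ZMod.neg_one_ne_one).symm
    rcases Nat.even_or_odd m with hm' | hm'
    · rw [hm'.neg_one_pow] at h3 ⊢
      rcases he with rfl | rfl
      · simp at h3; exact absurd h3 hne
      · rfl
    · rw [hm'.neg_one_pow] at h3 ⊢
      rcases he with rfl | rfl
      · rfl
      · simp at h3; exact absurd h3 hne
  rcases hcases with h | h
  · rw [← key 1 (Or.inl rfl) (by rw [h]; simp), h, hP]; simp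
  · rw [← key (-1) (Or.inr rfl) (by rw [h]; simp), h, hP]; simp

lemma witt_int_ne {p : ℕ} [Fact p.Prime] [CharP F p] {z : ℤ} (hz : z ≠ 0) :
    ((z : ℤ) : WittVector p F) ≠ 0 := by
  intro h
  have h1 : ∀ k : ℕ, (p : ℤ) ^ k ∣ z := fun k =>
    int_dvd_of_witt (F := F) k z (by rw [h]; exact dvd_zero _)
  have hp2 := (Fact.out : p.Prime).two_le
  have := Int.le_of_dvd (abs_pos.2 hz) ((dvd_abs _ _).2 (h1 z.natAbs))
  have h3 : z.natAbs < p ^ z.natAbs := Nat.lt_pow_self (by omega)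
  have h4 : |z| = (z.natAbs : ℤ) := by simp
  rw [h4] at this
  have : p ^ z.natAbs ≤ z.natAbs := by exact_mod_cast this
  omega

lemma hfrob {p : ℕ} [Fact p.Prime] [CharP F p] (hodd : Odd p) (s : Fˣ) :
    quadraticChar F (((s ^ p : Fˣ) : F) + ((s ^ p)⁻¹ : Fˣ)) =
      quadraticChar F ((s : F) + (s⁻¹ : Fˣ)) := by
  rw [← quad_pow_odd hodd ((s : F) + (s⁻¹ : Fˣ)), add_pow_char]
  simp

lemma int_part {l p m : ℕ} [Fact p.Prime] [CharP F p] (hl : l.Prime) (hl4 : l % 4 = 1)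
    (hp4 : p % 4 = 1) (hgen : ∀ k, ¬ l ∣ k → ∃ i, p ^ i ≡ k [MOD l])
    (hord : orderOf (p : ZMod l) = l - 1) (hF : Fintype.card F = p ^ ((l - 1) * m)) {D : ℕ}
    (hD : p ^ ((l - 1) * m) - 1 = D * (4 * l)) (hD0 : 0 < D)
    (hd : l ∣ Fintype.card Fˣ) (hcop : (Fintype.card Fˣ).Coprime p)
    (ψ : MulChar F ℂ) (hψ1 : ψ ≠ 1) (hψ : ψ ^ l = 1) :
    ∃ k : ℤ, ∑ s : Fˣ, (ψ s) ^ 2 * qc F ((s : F) + (s⁻¹ : Fˣ)) =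
        (((p : ℤ) ^ ((l - 1) / 2 * m) * k : ℤ) : ℂ) ∧
      ∑ t : Fˣ, quadraticChar F (((t ^ l : Fˣ) : F) + ((t ^ l)⁻¹ : Fˣ))
        - ∑ s : Fˣ, quadraticChar F ((s : F) + (s⁻¹ : Fˣ))
        = ((l : ℤ) - 1) * ((p : ℤ) ^ ((l - 1) / 2 * m) * k) := by
  have hl2 := hl.two_le
  have hl3 : (l : ℤ) - 1 ≠ 0 := by omega
  have hodd : Odd p := Nat.odd_iff.2 (by omega)
  let Ψ : Fˣ →* ℂ := (Units.coeHom ℂ).comp (ψ ^ 2).toUnitHom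
  have hΨ : ∀ s, Ψ s = ψ s ^ 2 := fun s => by
    rw [← MulChar.pow_apply_coe]; exact MulChar.coe_toUnitHom (ψ ^ 2) s
  have h2 : ψ ^ 2 ≠ 1 := pow_ne_one_of_prime hl hψ1 hψ (by
    intro h
    have := Nat.le_of_dvd (by norm_num) h
    omega)
  set z : ℤ := ∑ t : Fˣ, quadraticChar F (((t ^ l : Fˣ) : F) + ((t ^ l)⁻¹ : Fˣ))
        - ∑ s : Fˣ, quadraticChar F ((s : F) + (s⁻¹ : Fˣ)) with hz
  have hm := master (G := Fˣ) (R := ℂ) hl hcop hgen hd Ψ (by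
    intro h
    apply h2
    ext s
    rw [MulChar.pow_apply_coe, ← hΨ, h, MulChar.one_apply_coe]; rfl) (by
    intro s
    rw [hΨ, ← pow_mul, mul_comm, pow_mul, ← MulChar.pow_apply_coe, hψ, MulChar.one_apply_coe,
      one_pow])
    (fun s => ((quadraticChar F ((s : F) + (s⁻¹ : Fˣ)) : ℤ) : ℂ)) (by
      intro s; simp only [hfrob hodd])
  have hm2 : (z : ℂ) = (((l : ℤ) - 1 : ℤ) : ℂ) * 
      ∑ s : Fˣ, (ψ s) ^ 2 * qc F ((s : F) + (s⁻¹ : Fˣ)) := by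
    simp only [hΨ] at hm
    rw [hz]; push_cast; push_cast at hm; exact hm
  obtain ⟨k, hk1, hk2⟩ := int_dvd_of_integral hl3 (by
    refine IsIntegral.sum _ fun s _ => ?_
    exact ((isIntegral_mulChar ψ s).pow 2).mul (isIntegral_mulChar _ _)) hm2
  obtain ⟨w, hw1, hw2, hw3⟩ := witt_dvd hl hl4 hp4 hord hD hD0 F hF
  have hm3 := master (G := Fˣ) (R := WittVector p F) hl hcop hgen hd w hw1 hw2
    (fun s => ((quadraticChar F ((s : F) + (s⁻¹ : Fˣ)) : ℤ) : WittVector p F)) (by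
      intro s; simp only [hfrob hodd])
  have hm4 : ((z : ℤ) : WittVector p F) = (((l : ℤ) - 1 : ℤ) : WittVector p F) * 
      ∑ s : Fˣ, w s * ((quadraticChar F ((s : F) + (s⁻¹ : Fˣ)) : ℤ) : WittVector p F) := by
    rw [hz]; push_cast; push_cast at hm3; exact hm3
  rw [hk1, Int.cast_mul] at hm4
  have hm5 := mul_left_cancel₀ (witt_int_ne (F := F) hl3) hm4
  rw [← hm5, show (l - 1) * m / 2 = (l - 1) / 2 * m by
    rw [show (l - 1) * m = ((l - 1) / 2 * m) * 2 by rw [mul_right_comm]; congr 1; omega]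
    simp] at hw3
  obtain ⟨k', hk'⟩ := int_dvd_of_witt (F := F) _ k hw3
  exact ⟨k', by rw [hk2, hk'], by rw [hk1, hk']⟩

end

end ChebAux

namespace ChebAux

set_option linter.unusedSectionVars false

section

variable {F : Type*} [Field F] [Fintype F] [DecidableEq F]

lemma mod8 (P k e : ℤ) (hP : P % 4 = 1) (hk : k ^ 2 ≤ 4) (he : e = 1 ∨ e = -1)
    (h : (8 : ℤ) ∣ P ^ 2 + (2 + e * P) * (P * k) + (2 + e * P) ^ 2) : k = 2 * e := by
  have h1 : -2 ≤ k := by nlinarith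
  have h2 : k ≤ 2 := by nlinarith
  have hP8 : P % 8 = 1 ∨ P % 8 = 5 := by omega
  obtain ⟨t, ht⟩ : ∃ t, P = 8 * t + 1 ∨ P = 8 * t + 5 := ⟨P / 8, by omega⟩
  have hz := (ZMod.intCast_zmod_eq_zero_iff_dvd _ 8).2 h
  have ht' : ((P : ℤ) : ZMod 8) = 1 ∨ ((P : ℤ) : ZMod 8) = 5 := by
    have h8 : (8 : ZMod 8) = 0 := by decide
    rcases ht with rfl | rfl
    · left; push_cast; rw [h8]; simp
    · right; push_cast; rw [h8]; simp
  push_cast at hz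
  rcases he with rfl | rfl <;> rcases ht' with ht' | ht' <;> rw [ht'] at hz <;>
    interval_cases k <;> first | rfl | (exfalso; revert hz; decide)

lemma sum_congr_w (hF : ringChar F ≠ 2) (τ ψ : MulChar F ℂ) (hτ : τ ^ 4 = 1) (hψ : ψ ≠ 1)
    (hτψ : τ * ψ ≠ 1) : ∃ w : ℂ, IsIntegral ℤ w ∧
      jacobiSum (τ * ψ) (qc F) + jacobiSum ψ (qc F) + 2 = -2 * (1 + Complex.I) * w := by
  have h1 : jacobiSum (τ * ψ) (qc F) + jacobiSum ψ (qc F) =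
      ∑ x : F, (τ x + 1) * ψ x * (qc F (1 - x) - 1) := by
    have a1 := MulChar.sum_eq_zero_of_ne_one hψ
    have a2 := MulChar.sum_eq_zero_of_ne_one hτψ
    rw [← sub_zero (jacobiSum (τ * ψ) (qc F) + _), ← add_zero (0 : ℂ)]
    nth_rewrite 1 [← a1]
    rw [← a2, jacobiSum, jacobiSum, ← Finset.sum_add_distrib, ← Finset.sum_add_distrib,
      ← Finset.sum_sub_distrib]
    refine Finset.sum_congr rfl fun x _ => ?_
    rw [MulChar.mul_apply]; ring
  have h2 : ∀ x : F, ∃ w : ℂ, IsIntegral ℤ w ∧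
      (τ x + 1) * ψ x * (qc F (1 - x) - 1) + (if x = 1 then 2 else 0) =
        -2 * (1 + Complex.I) * w := by
    intro x
    by_cases hx1 : x = 1
    · subst hx1
      refine ⟨0, isIntegral_zero, ?_⟩
      simp [MulChar.map_zero]; norm_num
    by_cases hx0 : x = 0
    · subst hx0
      refine ⟨0, isIntegral_zero, ?_⟩
      simp [MulChar.map_zero]
    rcases qc_eq_one_of_ne (sub_ne_zero.2 (Ne.symm hx1)) with h | h
    · refine ⟨0, isIntegral_zero, ?_⟩
      simp [h, hx1]
    · obtain ⟨c, hc1, hc2⟩ := quarter (z := τ x) (by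
        rw [← MulChar.pow_apply' _ (by norm_num), hτ, MulChar.one_apply (isUnit_iff_ne_zero.2 hx0)])
      refine ⟨ψ x * c, (isIntegral_mulChar _ _).mul hc1, ?_⟩
      rw [h, if_neg hx1]
      linear_combination (-2 * ψ x) * hc2
  choose w hw1 hw2 using h2
  refine ⟨∑ x, w x, IsIntegral.sum _ fun x _ => hw1 x, ?_⟩
  rw [h1, Finset.mul_sum, ← Finset.sum_congr rfl (fun x _ => hw2 x), Finset.sum_add_distrib]
  simp

/-- everything about the split case -/
lemma split_case {l p m : ℕ} [Fact p.Prime] [CharP F p] (hl : l.Prime) (hl4 : l % 4 = 1)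
    (hp4 : p % 4 = 1) (hpl : p ≠ l) (hgen : ∀ k, ¬ l ∣ k → ∃ i, p ^ i ≡ k [MOD l])
    (hord : orderOf (p : ZMod l) = l - 1) (hm : 0 < m)
    (hF : Fintype.card F = p ^ ((l - 1) * m)) :
    (∀ τ ψ : MulChar F ℂ, τ ^ 2 = qc F → ψ ≠ 1 → ψ ^ l = 1 →
      jacobiSum (τ * ψ) (qc F) + (starRingEnd ℂ) (jacobiSum (τ * ψ) (qc F)) =
        ((2 * (-(-1) ^ m) * (p : ℤ) ^ ((l - 1) / 2 * m) : ℤ) : ℂ)) ∧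
      ∑ t : Fˣ, quadraticChar F (((t ^ l : Fˣ) : F) + ((t ^ l)⁻¹ : Fˣ))
        - ∑ s : Fˣ, quadraticChar F ((s : F) + (s⁻¹ : Fˣ))
        = ((l : ℤ) - 1) * (2 * (-(-1) ^ m) * (p : ℤ) ^ ((l - 1) / 2 * m)) := by
  have hp := (Fact.out : p.Prime)
  have hl2 := hl.two_le
  have hF2 := char_two_ne (F := F) (p := p) hp4
  obtain ⟨k4, hk4⟩ : ∃ k4, (l - 1) * m = 4 * k4 := ⟨(l - 1) / 4 * m, by
    rw [← mul_assoc]; congr 1; omega⟩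
  have h16 : Fintype.card F % 16 = 1 := by rw [hF, hk4]; exact pow_four_mod p k4 hp4
  have hldvd : l ∣ Fintype.card F - 1 := by
    rw [hF]
    rw [← CharP.cast_eq_zero_iff (ZMod l) l, Nat.cast_sub (Nat.one_le_pow _ _ hp.pos)]
    push_cast
    rw [pow_mul, ← hord, pow_orderOf_eq_one, one_pow, sub_self]
  have hq1 : 1 < Fintype.card F := Fintype.one_lt_card
  obtain ⟨D, hD⟩ : 4 * l ∣ Fintype.card F - 1 := by
    refine Nat.Coprime.mul_dvd_of_dvd_of_dvd ?_ (by omega) hldvd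
    rw [show 4 = 2 ^ 2 from rfl]
    apply Nat.Coprime.pow_left
    rw [Nat.coprime_two_left]
    exact Nat.odd_iff.2 (by omega)
  have hD0 : 0 < D := by
    rcases Nat.eq_zero_or_pos D with rfl | h
    · omega
    · exact h
  have hD' : p ^ ((l - 1) * m) - 1 = D * (4 * l) := by rw [← hF, hD, mul_comm]
  have hd : l ∣ Fintype.card Fˣ := by rw [Fintype.card_units]; exact hldvd
  have hcop : (Fintype.card Fˣ).Coprime p := by
    rw [Fintype.card_units, Nat.coprime_comm, hp.coprime_iff_not_dvd, hF]
    intro h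
    have h1 : p ∣ p ^ ((l - 1) * m) := dvd_pow_self p (by
      have : 0 < (l - 1) * m := Nat.mul_pos (by omega) hm
      omega)
    have := (Nat.dvd_sub_iff_right (Nat.one_le_pow _ _ hp.pos) h1).1 h
    exact hp.one_lt.ne' (Nat.dvd_one.1 this)
  set P : ℤ := (p : ℤ) ^ ((l - 1) / 2 * m) with hP
  have hP0 : 0 < P := by have := hp.pos; positivity
  have hP4 : P % 4 = 1 := by
    have := pow_mod_four p ((l - 1) / 2 * m) hp4
    rw [hP]; exact_mod_cast this
  have hPq : ((Fintype.card F : ℕ) : ℂ) = ((P ^ 2 : ℤ) : ℂ) := by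
    rw [hF, hP, ← pow_mul, show (l - 1) / 2 * m * 2 = (l - 1) * m by
      rw [mul_right_comm]; congr 1; omega]
    push_cast; rfl
  have main : ∀ τ ψ : MulChar F ℂ, τ ^ 2 = qc F → ψ ≠ 1 → ψ ^ l = 1 →
      jacobiSum (τ * ψ) (qc F) + (starRingEnd ℂ) (jacobiSum (τ * ψ) (qc F)) =
        ((2 * (-(-1) ^ m) * P : ℤ) : ℂ) ∧ 
      ∑ t : Fˣ, quadraticChar F (((t ^ l : Fˣ) : F) + ((t ^ l)⁻¹ : Fˣ))
        - ∑ s : Fˣ, quadraticChar F ((s : F) + (s⁻¹ : Fˣ))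
        = ((l : ℤ) - 1) * (2 * (-(-1) ^ m) * P) := by
    intro τ ψ hτ hψ1 hψ
    have hτ4 : τ ^ 4 = 1 := by
      rw [show 4 = 2 * 2 from rfl, pow_mul, hτ, qc_sq]
    have hψ4 : ψ ^ 4 ≠ 1 := pow_ne_one_of_prime hl hψ1 hψ (by
      intro h
      have := Nat.le_of_dvd (by norm_num) h
      interval_cases l <;> omega)
    have hρ4 : (τ * ψ) ^ 4 ≠ 1 := by rw [mul_pow, hτ4, one_mul]; exact hψ4
    have hρ1 : τ * ψ ≠ 1 := by intro h; rw [h, one_pow] at hρ4; exact hρ4 rfl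
    obtain ⟨k, hk1, hk2⟩ := int_part hl hl4 hp4 hgen hord hF hD' hD0 hd hcop ψ hψ1 hψ
    have hodd : Odd l := Nat.odd_iff.2 (by omega)
    rw [sum_f_eq (by omega) hF2 τ ψ hτ (odd_neg_one_val hodd ψ hψ),
      frob_psi hl hp4 hgen τ ψ hτ4 hψ] at hk1
    have ha := a_val hl hl4 hp4 hgen hord hF hd hcop ψ hψ1 hψ
    have hn := jac_norm hF2 (τ * ψ) hρ4
    obtain ⟨w, hw1, hw2⟩ := sum_congr_w hF2 τ ψ hτ4 hψ1 hρ1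
    rw [← hP] at ha hk1 hk2
    set J := jacobiSum (τ * ψ) (qc F)
    set e : ℤ := -(-1) ^ m with he
    have he1 : e = 1 ∨ e = -1 := by
      rcases neg_one_pow_eq_or ℤ m with h | h <;> rw [he, h] <;> simp
    rw [ha] at hw2
    have hw3 := congrArg (starRingEnd ℂ) hw2
    simp only [map_add, map_mul, map_intCast, map_neg, map_one, Complex.conj_I, map_ofNat] at hw3
    have hmul : ((P ^ 2 + (2 + e * P) * (P * k) + (2 + e * P) ^ 2 : ℤ) : ℂ) =
        ((8 : ℤ) : ℂ) * (w * (starRingEnd ℂ) w) := by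
      have hI := Complex.I_sq
      rw [hPq] at hn
      push_cast at hk1 hn hw2 hw3 ⊢
      rw [← hn, ← hk1]
      linear_combination (starRingEnd ℂ J + e * P + 2) * hw2 + (-2 * (1 + Complex.I) * w) * hw3 - 4 * w * (starRingEnd ℂ) w * hI
    obtain ⟨N, hN, -⟩ := int_dvd_of_integral (by norm_num) (hw1.mul (isIntegral_conj hw1)) hmul
    have hk : k = 2 * e := by
      refine mod8 P k e hP4 ?_ he1 ⟨N, hN⟩
      have h1 : J + (starRingEnd ℂ) J = ((2 * J.re : ℝ) : ℂ) := Complex.add_conj J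
      have h2 : J * (starRingEnd ℂ) J = ((Complex.normSq J : ℝ) : ℂ) := Complex.mul_conj J
      rw [h1] at hk1
      rw [h2, hPq] at hn
      have hk1' : 2 * J.re = (P : ℝ) * k := by exact_mod_cast hk1
      have hn' : Complex.normSq J = (P : ℝ) ^ 2 := by exact_mod_cast hn
      rw [Complex.normSq_apply] at hn'
      have h5 : (P : ℝ) ^ 2 * (k : ℝ) ^ 2 ≤ 4 * P ^ 2 := by
        rw [← mul_pow, ← hk1']; nlinarith [mul_self_nonneg J.im]
      have h6 : P ^ 2 * k ^ 2 ≤ P ^ 2 * 4 := by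
        have : P ^ 2 * k ^ 2 ≤ 4 * P ^ 2 := by exact_mod_cast h5
        linarith
      exact le_of_mul_le_mul_left h6 (by positivity)
    rw [hk] at hk1 hk2
    exact ⟨by rw [hk1]; congr 1; ring, by rw [hk2]; ring⟩
  refine ⟨fun τ ψ h1 h2 h3 => (main τ ψ h1 h2 h3).1, ?_⟩
  obtain ⟨τ, hτ⟩ := exists_tau (F := F) (by omega)
  obtain ⟨ψ, h1, h2⟩ := exists_psi (F := F) hl hldvd
  exact (main τ ψ hτ h1 h2).2

end

end ChebAux

namespace ChebAux

set_option linter.unusedSectionVars false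

section

variable {F : Type*} [Field F] [Fintype F] [DecidableEq F]
variable {K : Type*} [Field K] [Fintype K] [DecidableEq K] [Algebra F K]

lemma fixed_iff (z : K) : z ^ Fintype.card F = z ↔ ∃ x : F, algebraMap F K x = z := by
  constructor
  · intro hz
    have hne : (Polynomial.X ^ Fintype.card F - Polynomial.X : Polynomial K) ≠ 0 :=
      FiniteField.X_pow_card_sub_X_ne_zero K Fintype.one_lt_card
    have hsub : Finset.univ.image (algebraMap F K) ⊆
        (Polynomial.X ^ Fintype.card F - Polynomial.X : Polynomial K).roots.toFinset := by
      intro y hy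
      obtain ⟨x, -, rfl⟩ := Finset.mem_image.1 hy
      rw [Multiset.mem_toFinset, Polynomial.mem_roots hne]
      simp [← map_pow, FiniteField.pow_card]
    have hcard := Finset.eq_of_subset_of_card_le hsub (by
      refine (Multiset.toFinset_card_le _).trans ((Polynomial.card_roots' _).trans ?_)
      rw [FiniteField.X_pow_card_sub_X_natDegree_eq K Fintype.one_lt_card,
        Finset.card_image_of_injective _ (algebraMap F K).injective, Finset.card_univ])
    have : z ∈ (Polynomial.X ^ Fintype.card F - Polynomial.X : Polynomial K).roots.toFinset := by
      rw [Multiset.mem_toFinset, Polynomial.mem_roots hne]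
      simp [hz]
    rw [← hcard] at this
    obtain ⟨x, -, h⟩ := Finset.mem_image.1 this
    exact ⟨x, h⟩
  · rintro ⟨x, rfl⟩
    rw [← map_pow, FiniteField.pow_card]

/-- left inverse of the algebra map -/
noncomputable def dn (F : Type*) {K : Type*} [Field F] [Field K] [Algebra F K] : K → F :=
  Function.invFun (algebraMap F K)

lemma dn_algebraMap (x : F) : dn F (algebraMap F K x) = x :=
  Function.leftInverse_invFun (algebraMap F K).injective x

lemma algebraMap_dn {z : K} (hz : z ^ Fintype.card F = z) : algebraMap F K (dn F z) = z := by
  obtain ⟨x, rfl⟩ := (fixed_iff z).1 hz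
  rw [dn_algebraMap]

lemma fr_add (a b : K) : (a + b) ^ Fintype.card F = a ^ Fintype.card F + b ^ Fintype.card F :=
  map_add (FiniteField.frobeniusAlgHom F K) a b

lemma fr_sub (a b : K) : (a - b) ^ Fintype.card F = a ^ Fintype.card F - b ^ Fintype.card F :=
  map_sub (FiniteField.frobeniusAlgHom F K) a b

lemma fr_algebraMap (x : F) : (algebraMap F K x) ^ Fintype.card F = algebraMap F K x :=
  (fixed_iff _).2 ⟨x, rfl⟩

lemma fr_fr (hK : Fintype.card K = Fintype.card F ^ 2) (z : K) :
    (z ^ Fintype.card F) ^ Fintype.card F = z := by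
  rw [← pow_mul, ← sq, ← hK, FiniteField.pow_card]

lemma ringChar_eq : ringChar K = ringChar F := by
  have := charP_of_injective_algebraMap (algebraMap F K).injective (ringChar F)
  exact ringChar.eq K (ringChar F)

lemma isSquare_base (hF : ringChar F ≠ 2) (hK : Fintype.card K = Fintype.card F ^ 2) (x : F) :
    IsSquare (algebraMap F K x) := by
  by_cases hx : x = 0
  · subst hx; simp
  rw [FiniteField.isSquare_iff (by rwa [ringChar_eq (F := F)]) (by simpa using hx), ← map_pow, hK]
  have h1 := FiniteField.pow_card_sub_one_eq_one x hx
  have h2 : Fintype.card F % 2 = 1 := FiniteField.odd_card_of_char_ne_two hF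
  obtain ⟨k, hk⟩ : ∃ k, Fintype.card F = 2 * k + 1 := ⟨Fintype.card F / 2, by omega⟩
  have h3 : Fintype.card F ^ 2 / 2 = (Fintype.card F - 1) * (k + 1) := by
    rw [hk]
    have : (2 * k + 1) ^ 2 = 2 * (2 * k * (k + 1)) + 1 := by ring
    rw [this]; simp; omega
  rw [h3, pow_mul, h1]; simp

lemma exists_root (hF : ringChar F ≠ 2) (hK : Fintype.card K = Fintype.card F ^ 2) (x : F) :
    ∃ r : Kˣ, (r : K) + (r⁻¹ : Kˣ) = algebraMap F K x := by
  obtain ⟨s, hs⟩ := isSquare_base hF hK (x ^ 2 - 4)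
  have h2 : (2 : K) ≠ 0 := Ring.two_ne_zero (by rwa [ringChar_eq (F := F)])
  rw [map_sub, map_pow, map_ofNat] at hs
  set X := algebraMap F K x
  refine ⟨⟨(X + s) / 2, (X - s) / 2, ?_, ?_⟩, ?_⟩
  · field_simp; linear_combination hs
  · field_simp; linear_combination hs
  · simp only [Units.inv_mk]; field_simp; ring

lemma root_iff (r t : Kˣ) : (t : K) + (t⁻¹ : Kˣ) = r + (r⁻¹ : Kˣ) ↔ t = r ∨ t = r⁻¹ := by
  constructor
  · intro h
    have h1 : (t : K) * (t⁻¹ : Kˣ) = 1 := Units.mul_inv t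
    have h2 : (r : K) * (r⁻¹ : Kˣ) = 1 := Units.mul_inv r
    have : ((t : K) - r) * ((t : K) - (r⁻¹ : Kˣ)) = 0 := by
      linear_combination (t : K) * h - h1 + h2
    rcases mul_eq_zero.1 this with h | h
    · left; exact Units.ext (sub_eq_zero.1 h)
    · right; exact Units.ext (sub_eq_zero.1 h)
  · rintro (rfl | rfl)
    · rfl
    · rw [inv_inv, add_comm]

lemma fiber_two (hF : ringChar F ≠ 2) (hK : Fintype.card K = Fintype.card F ^ 2) (x : F) :
    (Finset.univ.filter (fun t : Kˣ => t ^ (Fintype.card F - 1) = 1 ∧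
        (t : K) + (t⁻¹ : Kˣ) = algebraMap F K x)).card +
    (Finset.univ.filter (fun t : Kˣ => t ^ (Fintype.card F + 1) = 1 ∧
        (t : K) + (t⁻¹ : Kˣ) = algebraMap F K x)).card = 2 := by
  obtain ⟨r, hr⟩ := exists_root hF hK x
  have hodd : Fintype.card F % 2 = 1 := FiniteField.odd_card_of_char_ne_two hF
  have hq : 1 < Fintype.card F := Fintype.one_lt_card
  simp only [← hr, root_iff]
  have h1 : r ^ Fintype.card F = r ∨ r ^ Fintype.card F = r⁻¹ := by
    rw [← root_iff]
    have := fr_algebraMap (K := K) x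
    rw [← hr, fr_add] at this
    rw [← inv_pow, Units.val_pow_eq_pow_val, Units.val_pow_eq_pow_val]; exact this
  have h2 : r ^ (Fintype.card F - 1) = 1 ∨ r ^ (Fintype.card F + 1) = 1 := by
    rcases h1 with h | h
    · left
      have : r ^ (Fintype.card F - 1) * r = r := by
        rw [← pow_succ, Nat.sub_add_cancel hq.le, h]
      simpa using this
    · right; rw [pow_succ, h, inv_mul_cancel]
  have h3 : r ^ (Fintype.card F + 1) = r ^ (Fintype.card F - 1) * r ^ 2 := by
    rw [← pow_add]; congr 1; omega
  by_cases hrr : r ^ 2 = 1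
  · have hinv : r⁻¹ = r := by rw [inv_eq_iff_mul_eq_one, ← sq, hrr]
    have e : ∀ k, k % 2 = 0 → Finset.univ.filter (fun t : Kˣ => t ^ k = 1 ∧ (t = r ∨ t = r⁻¹)) = {r} := by
      intro k hk
      ext t
      simp only [Finset.mem_filter, Finset.mem_univ, true_and, Finset.mem_singleton, hinv, or_self]
      constructor
      · exact fun h => h.2
      · rintro rfl
        refine ⟨?_, rfl⟩
        obtain ⟨j, rfl⟩ : ∃ j, k = 2 * j := ⟨k / 2, by omega⟩
        rw [pow_mul, hrr, one_pow]
    rw [e _ (by omega), e _ (by omega)]; rfl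
  · have hne : r ≠ r⁻¹ := by
      intro h; apply hrr; rw [sq]; nth_rewrite 1 [h]; simp
    have e1 : ∀ k, r ^ k = 1 → (Finset.univ.filter (fun t : Kˣ => t ^ k = 1 ∧ (t = r ∨ t = r⁻¹))).card = 2 := by
      intro k hk
      rw [← Finset.card_pair hne]
      congr 1
      ext t
      simp only [Finset.mem_filter, Finset.mem_univ, true_and, Finset.mem_insert, Finset.mem_singleton]
      constructor
      · exact fun h => h.2
      · rintro (rfl | rfl)
        · exact ⟨hk, Or.inl rfl⟩
        · exact ⟨by rw [inv_pow, hk, inv_one], Or.inr rfl⟩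
    have e0 : ∀ k, r ^ k ≠ 1 → (Finset.univ.filter (fun t : Kˣ => t ^ k = 1 ∧ (t = r ∨ t = r⁻¹))).card = 0 := by
      intro k hk
      rw [Finset.card_eq_zero, Finset.filter_eq_empty_iff]
      rintro t - ⟨ht, rfl | rfl⟩
      · exact hk ht
      · rw [inv_pow, inv_eq_one] at ht; exact hk ht
    rcases h2 with h | h
    · rw [e1 _ h, e0]
      rw [h3, h, one_mul]; exact hrr
    · rw [e1 _ h, e0]
      intro h'
      rw [h3, h', one_mul] at h; exact hrr h

lemma two_sum (hF : ringChar F ≠ 2) (hK : Fintype.card K = Fintype.card F ^ 2) (g : F → ℤ) :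
    2 * ∑ x, g x =
      ∑ t ∈ Finset.univ.filter (fun t : Kˣ => t ^ (Fintype.card F - 1) = 1),
        g (dn F ((t : K) + (t⁻¹ : Kˣ))) +
      ∑ t ∈ Finset.univ.filter (fun t : Kˣ => t ^ (Fintype.card F + 1) = 1),
        g (dn F ((t : K) + (t⁻¹ : Kˣ))) := by
  have hq : 1 < Fintype.card F := Fintype.one_lt_card
  have key : ∀ k, (∀ t : Kˣ, t ^ k = 1 → t ^ Fintype.card F = t ∨ t ^ Fintype.card F = t⁻¹) →
      ∑ t ∈ Finset.univ.filter (fun t : Kˣ => t ^ k = 1), g (dn F ((t : K) + (t⁻¹ : Kˣ))) =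
      ∑ x, (((Finset.univ.filter (fun t : Kˣ => t ^ k = 1 ∧
        (t : K) + (t⁻¹ : Kˣ) = algebraMap F K x)).card : ℕ) : ℤ) * g x := by
    intro k hk
    rw [← Finset.sum_fiberwise _ (fun t : Kˣ => dn F ((t : K) + (t⁻¹ : Kˣ)))]
    refine Finset.sum_congr rfl fun x _ => ?_
    rw [Finset.sum_congr rfl (g := fun _ => g x)]
    · rw [Finset.sum_const, nsmul_eq_mul, Finset.filter_filter]
      congr 3
      ext t
      simp only [Finset.mem_filter, Finset.mem_univ, true_and, and_congr_right_iff]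
      intro ht
      have hfix : ((t : K) + (t⁻¹ : Kˣ)) ^ Fintype.card F = (t : K) + (t⁻¹ : Kˣ) := by
        rw [fr_add]
        have := (root_iff t (t ^ Fintype.card F)).2 (hk t ht)
        rw [← this, ← inv_pow]; push_cast; rfl
      constructor
      · intro h; rw [← h, algebraMap_dn hfix]
      · intro h; rw [h, dn_algebraMap]
    · intro t ht; rw [(Finset.mem_filter.1 ht).2]
  rw [key, key, ← Finset.sum_add_distrib, Finset.mul_sum]
  · refine Finset.sum_congr rfl fun x _ => ?_
    rw [← add_mul]
    congr 1
    exact_mod_cast (fiber_two hF hK x).symm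
  · intro t ht; right; rw [eq_inv_iff_mul_eq_one, ← pow_succ, ht]
  · intro t ht; left
    rw [show Fintype.card F = Fintype.card F - 1 + 1 by omega, pow_succ, ht, one_mul]

lemma sum_split (g : K → ℤ) :
    ∑ t ∈ Finset.univ.filter (fun t : Kˣ => t ^ (Fintype.card F - 1) = 1), g t =
      ∑ s : Fˣ, g (algebraMap F K s) := by
  have hq : 1 < Fintype.card F := Fintype.one_lt_card
  symm
  refine Finset.sum_bij (fun s _ => Units.map (algebraMap F K).toMonoidHom s) ?_ ?_ ?_ ?_
  · intro s _
    simp only [Finset.mem_filter, Finset.mem_univ, true_and]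
    rw [← map_pow, ← Fintype.card_units, pow_card_eq_one, map_one]
  · intro a _ b _ h
    ext
    exact (algebraMap F K).injective (congrArg Units.val h)
  · intro t ht
    have ht := (Finset.mem_filter.1 ht).2
    have h2 : (t : K) ^ Fintype.card F = t := by
      have : t ^ Fintype.card F = t := by
        rw [show Fintype.card F = Fintype.card F - 1 + 1 by omega, pow_succ, ht, one_mul]
      exact congrArg Units.val this
    obtain ⟨x, hx⟩ := (fixed_iff _).1 h2
    have hx0 : x ≠ 0 := by rintro rfl; rw [map_zero] at hx; exact t.ne_zero hx.symm
    exact ⟨Units.mk0 x hx0, Finset.mem_univ _, Units.ext hx⟩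
  · intro s _; rfl

end

end ChebAux

namespace ChebAux

set_option linter.unusedSectionVars false

open Polynomial in
lemma cheb_count {F : Type*} [Field F] [Fintype F] [DecidableEq F] (hF : ringChar F ≠ 2)
    (D : F[X]) : (Nat.card {xy : F × F // xy.2 ^ 2 = D.eval xy.1} : ℤ) =
      Fintype.card F + ∑ x : F, quadraticChar F (D.eval x) := by
  rw [Nat.card_eq_fintype_card, Fintype.card_subtype]
  rw [Finset.card_eq_sum_card_fiberwise (f := Prod.fst) (t := Finset.univ) (by intro x _; simp)]
  push_cast
  rw [show (Fintype.card F : ℤ) = ∑ x : F, 1 by simp, ← Finset.sum_add_distrib]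
  refine Finset.sum_congr rfl fun x _ => ?_
  rw [add_comm, ← quadraticChar_card_sqrts hF]
  congr 1
  refine Finset.card_bij (fun a _ => a.2) ?_ ?_ ?_
  · rintro ⟨a, b⟩ h
    simp only [Finset.mem_filter, Finset.mem_univ, true_and] at h
    obtain ⟨h, rfl⟩ := h
    simpa using h
  · rintro ⟨a, b⟩ h ⟨a', b'⟩ h' e
    simp only [Finset.mem_filter, Finset.mem_univ, true_and] at h h' e
    rw [e, h.2, h'.2]
  · intro b hb
    exact ⟨(x, b), by simpa using hb, rfl⟩

section

variable {F : Type*} [Field F] [Fintype F] [DecidableEq F]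
variable {K : Type*} [Field K] [Fintype K] [DecidableEq K] [Algebra F K]

/-- the group of elements of norm one -/
abbrev V1 (F K : Type*) [Field F] [Fintype F] [Field K] : Subgroup Kˣ :=
  (powMonoidHom (Fintype.card F + 1) : Kˣ →* Kˣ).ker

lemma mem_V1 (t : Kˣ) : t ∈ V1 F K ↔ t ^ (Fintype.card F + 1) = 1 := by
  rw [MonoidHom.mem_ker]; rfl

lemma card_V1 (hK : Fintype.card K = Fintype.card F ^ 2) :
    Fintype.card (V1 F K) = Fintype.card F + 1 := by
  rw [← Nat.card_eq_fintype_card, IsCyclic.card_powMonoidHom_ker, Nat.card_eq_fintype_card,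
    Fintype.card_units, hK]
  apply Nat.gcd_eq_right
  have : Fintype.card F ^ 2 - 1 = (Fintype.card F + 1) * (Fintype.card F - 1) := by
    rw [← Nat.sq_sub_sq, one_pow]
  exact ⟨_, this⟩

/-- the function summed over the group of norm one elements -/
noncomputable def HV (F : Type*) {K : Type*} [Field F] [Fintype F] [DecidableEq F] [Field K]
    [Algebra F K] (t : Kˣ) : ℤ := quadraticChar F (dn F ((t : K) + (t⁻¹ : Kˣ)))

lemma fix_of_pm {t : Kˣ} (h : t ^ (Fintype.card F - 1) = 1 ∨ t ^ (Fintype.card F + 1) = 1) :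
    ((t : K) + (t⁻¹ : Kˣ)) ^ Fintype.card F = (t : K) + (t⁻¹ : Kˣ) := by
  have hq : 1 < Fintype.card F := Fintype.one_lt_card
  have h1 : t ^ Fintype.card F = t ∨ t ^ Fintype.card F = t⁻¹ := by
    rcases h with ht | ht
    · left
      rw [show Fintype.card F = Fintype.card F - 1 + 1 by omega, pow_succ, ht, one_mul]
    · right; rw [eq_inv_iff_mul_eq_one, ← pow_succ, ht]
  have := (root_iff t (t ^ Fintype.card F)).2 h1
  rw [fr_add, ← this, ← inv_pow]; push_cast; rfl

lemma dickson_dn {t : Kˣ} (h : t ^ (Fintype.card F - 1) = 1 ∨ t ^ (Fintype.card F + 1) = 1)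
    (d : ℕ) : (Polynomial.dickson 1 (1 : F) d).eval (dn F ((t : K) + (t⁻¹ : Kˣ))) =
      dn F (((t ^ d : Kˣ) : K) + ((t ^ d)⁻¹ : Kˣ)) := by
  rw [← dn_algebraMap (K := K) (Polynomial.eval _ _)]
  congr 1
  rw [← Polynomial.eval_map_apply, Polynomial.map_dickson, map_one, algebraMap_dn (fix_of_pm h),
    Polynomial.dickson_one_one_eval_add_inv _ _ (Units.mul_inv t), ← inv_pow]
  push_cast; rfl

lemma sum_formula (hF : ringChar F ≠ 2) (hK : Fintype.card K = Fintype.card F ^ 2) (d : ℕ) :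
    2 * ∑ x : F, quadraticChar F ((Polynomial.dickson 1 (1 : F) d).eval x) =
      ∑ s : Fˣ, quadraticChar F (((s ^ d : Fˣ) : F) + ((s ^ d)⁻¹ : Fˣ)) +
      ∑ t : V1 F K, HV F ((t ^ d : V1 F K) : Kˣ) := by
  rw [two_sum (K := K) hF hK (fun x => quadraticChar F ((Polynomial.dickson 1 (1 : F) d).eval x))]
  congr 1
  · have h1 := sum_split (F := F) (K := K) (fun t : K => quadraticChar F (dn F (t ^ d + (t ^ d)⁻¹)))
    rw [Finset.sum_congr rfl (g := fun t : Kˣ =>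
      quadraticChar F (dn F ((t : K) ^ d + ((t : K) ^ d)⁻¹))), h1]
    · refine Finset.sum_congr rfl fun s _ => ?_
      rw [← map_pow, ← map_inv₀, ← map_add, dn_algebraMap]
      simp
    · intro t ht
      rw [dickson_dn (Or.inl (Finset.mem_filter.1 ht).2)]
      simp
  · symm
    rw [Finset.sum_subtype (p := fun t => t ∈ V1 F K) _ (by intro x; simp [mem_V1])]
    refine Finset.sum_congr rfl fun t _ => ?_
    rw [dickson_dn (Or.inr ((mem_V1 _).1 t.2))]
    rfl

lemma sum_formula_one (hF : ringChar F ≠ 2) (hK : Fintype.card K = Fintype.card F ^ 2) :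
      ∑ s : Fˣ, quadraticChar F ((s : F) + (s⁻¹ : Fˣ)) +
      ∑ t : V1 F K, HV F (t : Kˣ) = 0 := by
  have h := sum_formula (K := K) hF hK 1
  simp only [Polynomial.dickson_one, Polynomial.eval_X, pow_one] at h
  rw [quadraticChar_sum_zero hF, mul_zero] at h
  exact h.symm

lemma sum_pow_eq {G : Type*} [CommGroup G] [Fintype G] {l : ℕ} (hl : l.Prime)
    (h : ¬ l ∣ Fintype.card G) (f : G → ℤ) : ∑ t : G, f (t ^ l) = ∑ t : G, f t := by
  have hc : (Nat.card G).Coprime l := by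
    rw [Nat.card_eq_fintype_card, Nat.coprime_comm, hl.coprime_iff_not_dvd]; exact h
  exact Equiv.sum_comp (powCoprime hc) f

end

end ChebAux

namespace ChebAux

set_option linter.unusedSectionVars false

section

variable {F : Type*} [Field F] [Fintype F] [DecidableEq F]
variable {K : Type*} [Field K] [Fintype K] [DecidableEq K] [Algebra F K]

lemma fix_tr (hK : Fintype.card K = Fintype.card F ^ 2) (z : K) :
    (z + z ^ Fintype.card F) ^ Fintype.card F = z + z ^ Fintype.card F := by
  rw [fr_add, fr_fr hK, add_comm]

/-- the trace map -/
noncomputable def tr (hK : Fintype.card K = Fintype.card F ^ 2) : K →+ F where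
  toFun z := dn F (z + z ^ Fintype.card F)
  map_zero' := by
    rw [zero_pow Fintype.card_ne_zero, add_zero, ← map_zero (algebraMap F K), dn_algebraMap]
  map_add' a b := by
    apply (algebraMap F K).injective
    rw [map_add, algebraMap_dn (fix_tr hK _), algebraMap_dn (fix_tr hK _),
      algebraMap_dn (fix_tr hK _), fr_add]; ring

lemma tr_apply (hK : Fintype.card K = Fintype.card F ^ 2)
    (z : K) : tr hK z = dn F (z + z ^ Fintype.card F) := rfl

lemma algebraMap_tr (hK : Fintype.card K = Fintype.card F ^ 2)
    (z : K) : algebraMap F K (tr hK z) = z + z ^ Fintype.card F :=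
  algebraMap_dn (fix_tr hK z)

lemma tr_mul (hK : Fintype.card K = Fintype.card F ^ 2)
    (a : F) (z : K) : tr hK (algebraMap F K a * z) = a * tr hK z := by
  apply (algebraMap F K).injective
  rw [algebraMap_tr, map_mul (algebraMap F K), algebraMap_tr, mul_pow, fr_algebraMap]; ring

lemma gauss_mul (hF : ringChar F ≠ 2) (ω : AddChar F ℂ) (c : F) :
    qc F c * gaussSum (qc F) ω = ∑ a : Fˣ, qc F a * ω (a * c) := by
  rw [sum_units_eq (fun a : F => qc F a * ω (a * c)) (by simp [MulChar.map_zero])]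
  by_cases hc : c = 0
  · subst hc
    simp [MulChar.map_zero, MulChar.sum_eq_zero_of_ne_one (qc_ne_one hF)]
  · have h := gaussSum_mulShift (qc F) ω (Units.mk0 c hc)
    rw [Units.val_mk0] at h
    rw [← h, ← mul_assoc]
    have h1 : qc F c * qc F c = 1 := by
      rcases qc_eq_one_of_ne hc with h | h <;> rw [h] <;> norm_num
    rw [h1, one_mul, gaussSum]
    refine Finset.sum_congr rfl fun a _ => ?_
    rw [AddChar.mulShift_apply, mul_comm c]

/-- lift of an additive character by the trace -/
noncomputable def omK (hK : Fintype.card K = Fintype.card F ^ 2) (ω : AddChar F ℂ) : AddChar K ℂ := ω.compAddMonoidHom (tr hK)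

lemma omK_apply (hK : Fintype.card K = Fintype.card F ^ 2)
    (ω : AddChar F ℂ) (z : K) : omK hK ω z = ω (tr hK z) := rfl

lemma W_eq (hK : Fintype.card K = Fintype.card F ^ 2)
    (hF : ringChar F ≠ 2) (ω : AddChar F ℂ) (θ : MulChar K ℂ) :
    gaussSum (qc F) ω * ∑ z : K, θ z * qc F (tr hK z) =
      (∑ a : Fˣ, qc F a * θ⁻¹ (algebraMap F K a)) * gaussSum θ (omK hK ω) := by
  rw [Finset.mul_sum, Finset.sum_mul]
  have h1 : ∀ z : K, gaussSum (qc F) ω * (θ z * qc F (tr hK z)) =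
      ∑ a : Fˣ, qc F a * (θ z * ω (a * tr hK z)) := by
    intro z
    rw [mul_left_comm, mul_comm (gaussSum _ _), gauss_mul hF, Finset.mul_sum]
    refine Finset.sum_congr rfl fun a _ => by ring
  simp only [h1]
  rw [Finset.sum_comm]
  refine Finset.sum_congr rfl fun a _ => ?_
  rw [← Finset.mul_sum, mul_assoc]
  congr 1
  have h2 := gaussSum_mulShift_eq θ (omK hK ω) (Units.map (algebraMap F K).toMonoidHom a)
  refine Eq.trans ?_ h2
  rw [gaussSum]
  refine Finset.sum_congr rfl fun z _ => ?_
  rw [AddChar.mulShift_apply, omK_apply]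
  congr 2
  exact (tr_mul hK a z).symm

lemma eta_base (hK : Fintype.card K = Fintype.card F ^ 2) (hF : ringChar F ≠ 2) {x : F} (hx : x ≠ 0) :
    quadraticChar K (algebraMap F K x) = 1 :=
  (quadraticChar_one_iff_isSquare (by simpa using hx)).2 (isSquare_base hF hK x)

lemma exists_v (hK : Fintype.card K = Fintype.card F ^ 2) (hF : ringChar F ≠ 2) (h4 : Fintype.card F % 4 = 1) :
    ∃ v : K, v ≠ 0 ∧ v ^ Fintype.card F = -v ∧ qc K v = -1 := by
  obtain ⟨d, hd⟩ := quadraticChar_exists_neg_one hF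
  have hd0 : d ≠ 0 := by rintro rfl; simp at hd
  obtain ⟨v, hv⟩ := isSquare_base hF hK d
  have hv0 : v ≠ 0 := by
    rintro rfl; simp at hv; exact hd0 hv
  have hKc : ringChar K ≠ 2 := by rwa [ringChar_eq (F := F)]
  have h1 : v ^ (Fintype.card F - 1) = -1 := by
    have h2 := quadraticChar_eq_pow_of_char_ne_two' hF d
    rw [hd] at h2
    rw [show Fintype.card F - 1 = 2 * (Fintype.card F / 2) by omega, pow_mul, sq, ← hv, ← map_pow,
      ← h2]
    simp
  have h2 : v ^ Fintype.card F = -v := by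
    rw [show Fintype.card F = Fintype.card F - 1 + 1 by omega, pow_succ, h1]; ring
  refine ⟨v, hv0, h2, ?_⟩
  have h3 : ((quadraticChar K v : ℤ) : K) = -1 := by
    rw [quadraticChar_eq_pow_of_char_ne_two' hKc]
    obtain ⟨k, hk⟩ : ∃ k, Fintype.card F = 4 * k + 1 := ⟨Fintype.card F / 4, by omega⟩
    have : Fintype.card K / 2 = (Fintype.card F - 1) * (2 * k + 1) := by
      rw [hK, hk]
      have : (4 * k + 1) ^ 2 = 2 * (4 * k * (2 * k + 1)) + 1 := by ring
      rw [this]; simp; omega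
    rw [this, pow_mul, h1, Odd.neg_one_pow (by simp)]
  rcases quadraticChar_dichotomy hv0 with h | h
  · rw [h] at h3
    exact absurd h3.symm (by simpa using Ring.neg_one_ne_one_of_char_ne_two hKc)
  · rw [qc_apply, h]; simp

lemma sum_tr_zero (hK : Fintype.card K = Fintype.card F ^ 2)
    (hF : ringChar F ≠ 2) (h4 : Fintype.card F % 4 = 1) :
    ∑ z : K, (if tr hK z = 0 then qc K z else 0) = -((Fintype.card F : ℂ) - 1) := by
  obtain ⟨v, hv0, hv, hqv⟩ := exists_v hK hF h4
  rw [← Finset.sum_filter]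
  have : ∑ z ∈ Finset.univ.filter (fun z : K => tr hK z = 0), qc K z =
      ∑ c : F, qc K (v * algebraMap F K c) := by
    symm
    refine Finset.sum_bij (fun c _ => v * algebraMap F K c) ?_ ?_ ?_ ?_
    · intro c _
      simp only [Finset.mem_filter, Finset.mem_univ, true_and]
      apply (algebraMap F K).injective
      rw [algebraMap_tr, mul_pow, hv, fr_algebraMap, map_zero]; ring
    · intro a _ b _ h
      exact (algebraMap F K).injective (mul_left_cancel₀ hv0 h)
    · intro z hz
      have hz := (Finset.mem_filter.1 hz).2
      have h1 := algebraMap_tr hK z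
      rw [hz, map_zero] at h1
      have h2 : (z / v) ^ Fintype.card F = z / v := by
        rw [div_pow, hv, show z ^ Fintype.card F = -z by linear_combination -h1, neg_div_neg_eq]
      obtain ⟨c, hc⟩ := (fixed_iff _).1 h2
      exact ⟨c, Finset.mem_univ _, by rw [hc]; field_simp⟩
    · intro c _; rfl
  rw [this]
  have h3 : ∀ c : F, qc K (v * algebraMap F K c) = -1 + if c = 0 then 1 else 0 := by
    intro c
    rw [map_mul, hqv]
    by_cases hc : c = 0
    · subst hc; simp [MulChar.map_zero]
    · rw [qc_apply, eta_base hK hF hc, if_neg hc]; simp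
  simp only [h3]
  rw [Finset.sum_add_distrib]
  simp; ring

lemma gauss_eta (hK : Fintype.card K = Fintype.card F ^ 2)
    (hF : ringChar F ≠ 2) (h4 : Fintype.card F % 4 = 1) {ω : AddChar F ℂ} (hω : ω ≠ 1) :
    gaussSum (qc K) (omK hK ω) = -(Fintype.card F : ℂ) := by
  have hKc : ringChar K ≠ 2 := by rwa [ringChar_eq (F := F)]
  have hq : 1 < Fintype.card F := Fintype.one_lt_card
  have h1 : ∀ a : Fˣ, ∑ z : K, qc K z * ω (a * tr hK z) = gaussSum (qc K) (omK hK ω) := by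
    intro a
    have h2 := gaussSum_mulShift (qc K) (omK hK ω) (Units.map (algebraMap F K).toMonoidHom a)
    have h3 : qc K ((Units.map (algebraMap F K).toMonoidHom a : Kˣ) : K) = 1 := by
      rw [qc_apply]
      have := eta_base hK hF a.ne_zero
      exact_mod_cast this
    rw [h3, one_mul] at h2
    rw [← h2, gaussSum]
    refine Finset.sum_congr rfl fun z _ => ?_
    rw [AddChar.mulShift_apply, omK_apply]
    congr 2
    exact (tr_mul hK a z).symm
  have h2 : ∑ a : Fˣ, ∑ z : K, qc K z * ω (a * tr hK z) =
      ((Fintype.card F : ℂ) - 1) * gaussSum (qc K) (omK hK ω) := by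
    simp only [h1]
    rw [Finset.sum_const, Finset.card_univ, Fintype.card_units, nsmul_eq_mul, Nat.cast_sub hq.le]
    simp
  have h3 : ∀ z : K, ∑ a : Fˣ, qc K z * ω (a * tr hK z) =
      (Fintype.card F : ℂ) * (if tr hK z = 0 then qc K z else 0) - qc K z := by
    intro z
    have e := sum_units_eq (fun a : F => qc K z * ω (a * tr hK z) - if a = 0 then qc K z else 0)
      (by simp)
    rw [Finset.sum_sub_distrib, Finset.sum_sub_distrib, ← Finset.mul_sum, ← Finset.mul_sum,
      AddChar.sum_mulShift _ (AddChar.IsPrimitive.of_ne_one hω)] at e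
    simp at e
    rw [← Finset.mul_sum, e]
    split_ifs <;> ring
  rw [Finset.sum_comm] at h2
  simp only [h3] at h2
  rw [Finset.sum_sub_distrib, ← Finset.mul_sum, sum_tr_zero hK hF h4,
    MulChar.sum_eq_zero_of_ne_one (qc_ne_one hKc)] at h2
  have hne : (Fintype.card F : ℂ) - 1 ≠ 0 := by
    rw [sub_ne_zero]; exact_mod_cast hq.ne'
  apply mul_left_cancel₀ hne
  rw [← h2]; ring

lemma W_zero (hK : Fintype.card K = Fintype.card F ^ 2)
    (hF : ringChar F ≠ 2) (h4 : Fintype.card F % 4 = 1) (θ : MulChar K ℂ)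
    (hθ : θ * qc K ≠ 1) (hJ : jacobiSum θ (qc K) = (Fintype.card F : ℂ)) :
    ∑ z : K, (1 + qc K z) * (θ z * qc F (tr hK z)) = 0 := by
  obtain ⟨ω, hω1⟩ := AddChar.exists_apply_ne_zero.2 (one_ne_zero (α := F))
  have hω : ω ≠ 1 := by rintro rfl; simp at hω1
  have hq0 : (Fintype.card F : ℂ) ≠ 0 := by exact_mod_cast Fintype.card_ne_zero
  have hg := gaussSum_ne_zero_of_nontrivial hq0 (qc_ne_one hF) (AddChar.IsPrimitive.of_ne_one hω)
  have h1 := W_eq hK hF ω θ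
  have h2 := W_eq hK hF ω (θ * qc K)
  have h3 := jacobiSum_mul_nontrivial hθ (omK hK ω)
  rw [hJ, gauss_eta hK hF h4 hω] at h3
  have h4 : gaussSum (θ * qc K) (omK hK ω) = - gaussSum θ (omK hK ω) := by
    apply mul_right_cancel₀ hq0
    rw [h3]; ring
  have h5 : ∀ a : Fˣ, (θ * qc K)⁻¹ (algebraMap F K a) = θ⁻¹ (algebraMap F K a) := by
    intro a
    rw [mul_inv, qc_inv, MulChar.mul_apply, qc_apply, eta_base hK hF a.ne_zero]; simp
  simp only [h5] at h2
  rw [h4] at h2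
  apply mul_left_cancel₀ hg
  rw [mul_zero, ← add_neg_cancel ((∑ a : Fˣ, qc F a * θ⁻¹ (algebraMap F K a)) *
    gaussSum θ (omK hK ω)), ← mul_neg, ← h2, ← h1, ← mul_add, ← Finset.sum_add_distrib]
  congr 1
  refine Finset.sum_congr rfl fun z _ => ?_
  rw [MulChar.mul_apply]; ring

lemma eta_norm (hK : Fintype.card K = Fintype.card F ^ 2) (hF : ringChar F ≠ 2) (w : K) :
    quadraticChar F (dn F (w ^ (Fintype.card F + 1))) = quadraticChar K w := by
  have hKc : ringChar K ≠ 2 := by rwa [ringChar_eq (F := F)]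
  apply Int.cast_injOn_of_ringChar_ne_two hKc
  · exact quadraticChar_isQuadratic F _
  · exact quadraticChar_isQuadratic K _
  · have hfix : (w ^ (Fintype.card F + 1)) ^ Fintype.card F = w ^ (Fintype.card F + 1) := by
      rw [pow_succ, mul_pow, fr_fr hK, mul_comm]
    have h1 := congrArg (algebraMap F K)
      (quadraticChar_eq_pow_of_char_ne_two' hF (dn F (w ^ (Fintype.card F + 1))))
    rw [map_pow, algebraMap_dn hfix, map_intCast] at h1
    rw [quadraticChar_eq_pow_of_char_ne_two' hKc, h1, ← pow_mul]
    congr 1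
    have h2 : Fintype.card F % 2 = 1 := FiniteField.odd_card_of_char_ne_two hF
    obtain ⟨k, hk⟩ : ∃ k, Fintype.card F = 2 * k + 1 := ⟨Fintype.card F / 2, by omega⟩
    rw [hK, hk]
    have : (2 * k + 1) ^ 2 = 2 * ((2 * k + 1 + 1) * k) + 1 := by ring
    rw [this, show (2 * k + 1) / 2 = k by omega]; omega

end

end ChebAux

namespace ChebAux

set_option linter.unusedSectionVars false

section

variable {F : Type*} [Field F] [Fintype F] [DecidableEq F]
variable {K : Type*} [Field K] [Fintype K] [DecidableEq K] [Algebra F K]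

lemma card_unitsK (hK : Fintype.card K = Fintype.card F ^ 2) :
    Fintype.card Kˣ = (Fintype.card F + 1) * (Fintype.card F - 1) := by
  rw [Fintype.card_units, hK, ← Nat.sq_sub_sq, one_pow]

lemma exists_pow_of_V1 (hK : Fintype.card K = Fintype.card F ^ 2) {s : Kˣ}
    (hs : s ∈ V1 F K) : ∃ w : Kˣ, w ^ (Fintype.card F - 1) = s := by
  rw [mem_V1] at hs
  obtain ⟨g, hg⟩ := IsCyclic.exists_generator (α := Kˣ)
  obtain ⟨k, rfl⟩ := Subgroup.mem_zpowers_iff.1 (hg s) 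
  have ho := orderOf_eq_card_of_forall_mem_zpowers hg
  rw [Nat.card_eq_fintype_card, card_unitsK hK] at ho
  rw [← zpow_natCast, ← zpow_mul] at hs
  have h1 := orderOf_dvd_iff_zpow_eq_one.2 hs
  rw [ho] at h1
  push_cast at h1
  rw [mul_comm k] at h1
  have h2 := (mul_dvd_mul_iff_left (by positivity : ((Fintype.card F : ℤ) + 1) ≠ 0)).1 h1
  obtain ⟨j, hj⟩ := h2
  refine ⟨g ^ j, ?_⟩
  rw [hj, ← zpow_natCast, ← zpow_mul, mul_comm]

lemma sum_V1 (hK : Fintype.card K = Fintype.card F ^ 2) (g : Kˣ → ℂ) :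
    ∑ w : Kˣ, g (w ^ (Fintype.card F - 1)) =
      ((Fintype.card F - 1 : ℕ) : ℂ) * ∑ t : V1 F K, g t := by
  rw [sum_pow_fiber]
  refine Eq.trans (Finset.sum_congr (g := fun s : Kˣ =>
    if s ∈ V1 F K then ((Fintype.card F - 1 : ℕ) : ℂ) * g s else 0) rfl fun s _ => ?_) ?_
  · split_ifs with h
    · obtain ⟨w, rfl⟩ := exists_pow_of_V1 hK h
      have hc := card_fiber_pow (G := Kˣ) (l := Fintype.card F - 1)
        ⟨_, (card_unitsK hK).trans (mul_comm _ _)⟩ w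
      congr 2
    · have hc : ∀ w : Kˣ, w ^ (Fintype.card F - 1) ≠ s := by
        intro w hw
        apply h
        rw [mem_V1, ← hw, ← pow_mul, mul_comm, ← card_unitsK hK, pow_card_eq_one]
      simp [hc]
  rw [← Finset.sum_filter, ← Finset.mul_sum]
  congr 1
  exact Finset.sum_subtype _ (by simp) g

lemma term_eq (hK : Fintype.card K = Fintype.card F ^ 2) (hF : ringChar F ≠ 2)
    {τ ψ : MulChar K ℂ} (hτ : τ ^ 2 = qc K) (hψ : ψ ^ (Fintype.card F + 1) = 1) (w : Kˣ) :
    ψ⁻¹ ((w ^ (Fintype.card F - 1) : Kˣ) : K) *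
      ((HV F (w ^ (Fintype.card F - 1)) : ℤ) : ℂ) =
    (τ * ψ) ((w : K) ^ 2) * qc F (tr hK ((w : K) ^ 2)) := by
  have hq : 1 < Fintype.card F := Fintype.one_lt_card
  set q := Fintype.card F with hqdef
  have hfix : (((w ^ (q - 1) : Kˣ) : K) + ((w ^ (q - 1))⁻¹ : Kˣ)) ^ q =
      ((w ^ (q - 1) : Kˣ) : K) + ((w ^ (q - 1))⁻¹ : Kˣ) := by
    apply fix_of_pm
    right
    rw [← pow_mul, mul_comm, ← hqdef, ← card_unitsK hK, pow_card_eq_one]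
  have hfixN : ((w : K) ^ (q + 1)) ^ q = (w : K) ^ (q + 1) := by
    rw [pow_succ, mul_pow, fr_fr hK, mul_comm]
  have h1 : dn F (((w ^ (q - 1) : Kˣ) : K) + ((w ^ (q - 1))⁻¹ : Kˣ)) * dn F ((w : K) ^ (q + 1)) =
      tr hK ((w : K) ^ 2) := by
    apply (algebraMap F K).injective
    rw [map_mul, algebraMap_tr, algebraMap_dn hfix, algebraMap_dn hfixN, ← hqdef]
    have e1 : (w : K) ^ (q + 1) = ((w ^ (q - 1) : Kˣ) : K) * w ^ 2 := by
      rw [Units.val_pow_eq_pow_val, ← pow_add]; congr 1; omega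
    have e2 : ((w ^ (q - 1) : Kˣ) : K) * (w : K) ^ (q + 1) = (w ^ 2) ^ q := by
      rw [Units.val_pow_eq_pow_val, ← pow_add, ← pow_mul]; congr 1; omega
    rw [add_mul, e2, e1, ← mul_assoc, Units.inv_mul, one_mul, add_comm]
  have h2 : HV F (w ^ (q - 1)) * quadraticChar K (w : K) = quadraticChar F (tr hK ((w : K) ^ 2)) := by
    rw [← h1, map_mul, HV, ← eta_norm hK hF]
  have h3 : ((HV F (w ^ (q - 1)) : ℤ) : ℂ) * qc K w = qc F (tr hK ((w : K) ^ 2)) := by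
    rw [qc_apply, qc_apply, ← h2]; push_cast; rfl
  have h4 : qc K (w : K) = τ w ^ 2 := by
    rw [← hτ, MulChar.pow_apply_coe]
  have h5 : qc K (w : K) * qc K (w : K) = 1 := by
    rcases qc_eq_one_of_ne w.ne_zero with h | h <;> rw [h] <;> norm_num
  have h6 : ψ (w : K) ^ (q + 1) = 1 := by
    rw [← MulChar.pow_apply_coe, hψ, MulChar.one_apply_coe]
  have h7 : ψ⁻¹ (w : K) * ψ (w : K) = 1 := by
    rw [← MulChar.mul_apply, inv_mul_cancel, MulChar.one_apply_coe]
  have h8 : ψ⁻¹ ((w ^ (q - 1) : Kˣ) : K) = ψ (w : K) ^ 2 := by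
    rw [Units.val_pow_eq_pow_val, map_pow]
    have : (ψ⁻¹ (w : K)) ^ (q - 1) * ψ (w : K) ^ (q - 1) = 1 := by rw [← mul_pow, h7, one_pow]
    rw [show q + 1 = (q - 1) + 2 by omega, pow_add] at h6
    linear_combination (ψ (w : K)) ^ 2 * this - (ψ⁻¹ (w : K)) ^ (q - 1) * h6
  rw [h8, ← h3, map_pow, MulChar.mul_apply, mul_pow, ← h4]
  linear_combination -(ψ (w : K)) ^ 2 * ((HV F (w ^ (q - 1)) : ℤ) : ℂ) * h5

lemma E1_zero (hK : Fintype.card K = Fintype.card F ^ 2) (hF : ringChar F ≠ 2)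
    (h4 : Fintype.card F % 4 = 1)
    {τ ψ : MulChar K ℂ} (hτ : τ ^ 2 = qc K) (hψ : ψ ^ (Fintype.card F + 1) = 1)
    (hθ : (τ * ψ) * qc K ≠ 1) (hJ : jacobiSum (τ * ψ) (qc K) = (Fintype.card F : ℂ)) :
    ∑ t : V1 F K, ψ⁻¹ ((t : Kˣ) : K) * ((HV F (t : Kˣ) : ℤ) : ℂ) = 0 := by
  have hKc : ringChar K ≠ 2 := by rwa [ringChar_eq (F := F)]
  have hq : 1 < Fintype.card F := Fintype.one_lt_card
  have h1 := sum_V1 hK (fun t : Kˣ => ψ⁻¹ (t : K) * ((HV F t : ℤ) : ℂ))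
  simp only [term_eq hK hF hτ hψ] at h1
  have h0 : (τ * ψ) ((0 : K) ^ 2) * qc F (tr hK ((0 : K) ^ 2)) = 0 := by
    rw [zero_pow two_ne_zero, MulChar.map_zero, zero_mul]
  rw [sum_units_eq (fun w : K => (τ * ψ) (w ^ 2) * qc F (tr hK (w ^ 2))) h0,
    sum_sq_eq hKc (fun z : K => (τ * ψ) z * qc F (tr hK z))] at h1
  have h2 := W_zero hK hF h4 (τ * ψ) hθ hJ
  have h3 := h1.symm.trans h2
  have hne : ((Fintype.card F - 1 : ℕ) : ℂ) ≠ 0 := by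
    exact_mod_cast (by omega : Fintype.card F - 1 ≠ 0)
  exact (mul_eq_zero.1 h3).resolve_left hne

lemma HV_pow {p : ℕ} [Fact p.Prime] [CharP F p] (hp4 : p % 4 = 1) (t : V1 F K) :
    HV F ((t ^ p : V1 F K) : Kˣ) = HV F (t : Kˣ) := by
  have := charP_of_injective_algebraMap (algebraMap F K).injective p
  rw [HV, HV]
  refine Eq.trans ?_ (quad_pow_odd (p := p) (Nat.odd_iff.2 (by omega)) _)
  congr 1
  apply (algebraMap F K).injective
  have hmem : ∀ s : V1 F K, (((s : Kˣ) : K) + ((s : Kˣ)⁻¹ : Kˣ)) ^ Fintype.card F =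
      ((s : Kˣ) : K) + ((s : Kˣ)⁻¹ : Kˣ) := fun s => fix_of_pm (Or.inr ((mem_V1 _).1 s.2))
  rw [map_pow, algebraMap_dn (hmem _), algebraMap_dn (hmem _), add_pow_char]
  simp [inv_pow]

/-- the norm-one part of the sum in the case where `l` divides `q + 1` -/
lemma nonsplit_case {l p m : ℕ} [Fact p.Prime] [CharP F p] (hl : l.Prime) (hl4 : l % 4 = 1)
    (hp4 : p % 4 = 1) (hpl : p ≠ l) (hgen : ∀ k, ¬ l ∣ k → ∃ i, p ^ i ≡ k [MOD l])
    (hord : orderOf (p : ZMod l) = l - 1) (hm : Odd m)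
    (hF : Fintype.card F = p ^ ((l - 1) / 2 * m)) (hK : Fintype.card K = Fintype.card F ^ 2)
    (hd : l ∣ Fintype.card F + 1) :
    ∑ t : V1 F K, HV F ((t ^ l : V1 F K) : Kˣ) = ∑ t : V1 F K, HV F (t : Kˣ) := by
  have hp := (Fact.out : p.Prime)
  have hl2 := hl.two_le
  have : CharP K p := charP_of_injective_algebraMap (algebraMap F K).injective p
  have hF2 := char_two_ne (F := F) (p := p) hp4
  have hK2 := char_two_ne (F := K) (p := p) hp4
  have hq1 : 1 < Fintype.card F := Fintype.one_lt_card
  have hq4 : Fintype.card F % 4 = 1 := by rw [hF]; exact pow_mod_four p _ hp4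
  have hKp : Fintype.card K = p ^ ((l - 1) * m) := by
    rw [hK, hF, ← pow_mul, show (l - 1) / 2 * m * 2 = (l - 1) * m by
      rw [mul_right_comm]; congr 1; omega]
  have hK8 : Fintype.card K % 8 = 1 := by
    rw [hK, Nat.pow_mod]
    have : Fintype.card F % 8 = 1 ∨ Fintype.card F % 8 = 5 := by omega
    rcases this with h | h <;> rw [h]
  have hlK : l ∣ Fintype.card K - 1 := by
    rw [← Fintype.card_units, card_unitsK hK]; exact hd.mul_right _
  obtain ⟨τ, hτ⟩ := exists_tau hK8
  obtain ⟨ψ, hψ1, hψ⟩ := exists_psi hl hlK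
  have hτ4 : τ ^ 4 = 1 := by
    rw [show 4 = 2 * 2 from rfl, pow_mul, hτ, qc_sq]
  have hψ4 : ψ ^ 4 ≠ 1 := pow_ne_one_of_prime hl hψ1 hψ (by
    intro h
    have := Nat.le_of_dvd (by norm_num) h
    have : l = 1 ∨ l = 2 ∨ l = 3 ∨ l = 4 := by omega
    omega)
  have hθ4 : (τ * ψ) ^ 4 ≠ 1 := by rw [mul_pow, hτ4, one_mul]; exact hψ4
  have hθ : (τ * ψ) * qc K ≠ 1 := by
    intro h
    apply hθ4
    have h1 := congrArg (· ^ 4) h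
    simp only [mul_pow (τ * ψ), one_pow] at h1
    rwa [show (qc K) ^ 4 = 1 by rw [show 4 = 2 * 2 from rfl, pow_mul, qc_sq, one_pow], mul_one] at h1
  have hJ : jacobiSum (τ * ψ) (qc K) = (Fintype.card F : ℂ) := by
    have h1 := (split_case (F := K) hl hl4 hp4 hpl hgen hord hm.pos hKp).1 τ ψ hτ hψ1 hψ
    have h2 := jac_norm hK2 (τ * ψ) hθ4
    rw [hm.neg_one_pow] at h1
    have h3 : ((Fintype.card F : ℕ) : ℂ) = (p : ℂ) ^ ((l - 1) / 2 * m) := by rw [hF]; push_cast; rfl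
    push_cast at h1
    rw [← h3] at h1
    rw [hK] at h2
    push_cast at h2
    have h4 : (jacobiSum (τ * ψ) (qc K) - (Fintype.card F : ℂ)) ^ 2 = 0 := by
      linear_combination jacobiSum (τ * ψ) (qc K) * h1 - h2
    exact sub_eq_zero.1 (pow_eq_zero_iff two_ne_zero |>.1 h4)
  have hψq : ψ ^ (Fintype.card F + 1) = 1 := by
    obtain ⟨c, hc⟩ := hd
    rw [hc, pow_mul, hψ, one_pow]
  have hE := E1_zero hK hF2 hq4 hτ hψq hθ hJ
  have hcop : (Fintype.card (V1 F K)).Coprime p := by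
    rw [card_V1 hK, Nat.coprime_comm, hp.coprime_iff_not_dvd, hF]
    intro h
    have hm0 := hm.pos
    have h1 : p ∣ p ^ ((l - 1) / 2 * m) := dvd_pow_self p (by
      have : 0 < (l - 1) / 2 * m := Nat.mul_pos (by omega) hm0
      omega)
    exact hp.one_lt.ne' (Nat.dvd_one.1 ((Nat.dvd_add_right h1).1 h))
  let Ψ : V1 F K →* ℂ :=
    { toFun := fun t => ψ⁻¹ ((t : Kˣ) : K)
      map_one' := by simp
      map_mul' := by intro a b; simp }
  have hΨ : Ψ ≠ 1 := by
    intro h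
    have hlq : ¬ l ∣ Fintype.card F - 1 := by
      intro h1
      have h2 := (Nat.dvd_sub hd h1)
      rw [show Fintype.card F + 1 - (Fintype.card F - 1) = 2 by omega] at h2
      have := Nat.le_of_dvd (by norm_num) h2
      omega
    have hi1 : ψ⁻¹ ≠ 1 := by simpa using hψ1
    have hil : (ψ⁻¹) ^ l = 1 := by rw [inv_pow, hψ, inv_one]
    apply pow_ne_one_of_prime hl hi1 hil hlq
    ext w
    have hw : w ^ (Fintype.card F - 1) ∈ V1 F K := by
      rw [mem_V1, ← pow_mul, mul_comm, ← card_unitsK hK, pow_card_eq_one]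
    have h3 := DFunLike.congr_fun h ⟨_, hw⟩
    rw [MulChar.pow_apply_coe, MulChar.one_apply_coe, ← map_pow, ← Units.val_pow_eq_pow_val]
    exact h3
  have hΨl : ∀ s, Ψ s ^ l = 1 := by
    intro s
    change (ψ⁻¹ ((s : Kˣ) : K)) ^ l = 1
    rw [← MulChar.pow_apply_coe, inv_pow, hψ, inv_one, MulChar.one_apply_coe]
  have hM := master hl hcop hgen (by rw [card_V1 hK]; exact hd) Ψ hΨ hΨl
    (fun t => ((HV F (t : Kˣ) : ℤ) : ℂ)) (fun s => by rw [HV_pow hp4])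
  have hE' : ∑ s : V1 F K, Ψ s * ((HV F (s : Kˣ) : ℤ) : ℂ) = 0 := hE
  rw [hE', mul_zero, sub_eq_zero] at hM
  exact_mod_cast hM

end

end ChebAux

namespace ChebAux

set_option linter.unusedSectionVars false

lemma hgen_of_prim {l p : ℕ} (hl : l.Prime) (u : (ZMod l)ˣ) (hu : (u : ZMod l) = (p : ZMod l))
    (hprim : ∀ x : (ZMod l)ˣ, x ∈ Subgroup.zpowers u) (k : ℕ) (hk : ¬ l ∣ k) :
    ∃ i, p ^ i ≡ k [MOD l] := by
  have : Fact l.Prime := ⟨hl⟩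
  have hk0 : (k : ZMod l) ≠ 0 := by rwa [Ne, ZMod.natCast_eq_zero_iff]
  have h1 := hprim (Units.mk0 _ hk0)
  rw [← mem_powers_iff_mem_zpowers] at h1
  obtain ⟨i, hi⟩ := h1
  refine ⟨i, ?_⟩
  rw [← ZMod.natCast_eq_natCast_iff]
  have h2 := congrArg (Units.val) hi
  simp only [Units.val_pow_eq_pow_val, hu, Units.val_mk0] at h2
  push_cast
  exact h2

lemma hord_of_prim {l p : ℕ} (hl : l.Prime) (u : (ZMod l)ˣ) (hu : (u : ZMod l) = (p : ZMod l))
    (hprim : ∀ x : (ZMod l)ˣ, x ∈ Subgroup.zpowers u) : orderOf (p : ZMod l) = l - 1 := by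
  have : Fact l.Prime := ⟨hl⟩
  rw [← hu, orderOf_units, orderOf_eq_card_of_forall_mem_zpowers hprim, Nat.card_eq_fintype_card,
    ZMod.card_units]

section

variable {F : Type*} [Field F] [Fintype F] [DecidableEq F]

lemma charSum {l p n : ℕ} [Fact p.Prime] [CharP F p] (hl : l.Prime) (hl4 : l % 4 = 1)
    (hp4 : p % 4 = 1) (hpl : p ≠ l) (hgen : ∀ k, ¬ l ∣ k → ∃ i, p ^ i ≡ k [MOD l])
    (hord : orderOf (p : ZMod l) = l - 1) (hn : 1 ≤ n) (hF : Fintype.card F = p ^ n) :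
    (¬ (l - 1) ∣ n → ∑ x : F, quadraticChar F ((Polynomial.dickson 1 (1 : F) l).eval x) = 0) ∧
    (∀ m, n = (l - 1) * m → ∑ x : F, quadraticChar F ((Polynomial.dickson 1 (1 : F) l).eval x) =
      -(((l : ℤ) - 1) * (-1) ^ m * (p : ℤ) ^ ((l - 1) / 2 * m))) := by
  classical
  have hp := (Fact.out : p.Prime)
  have hl2 := hl.two_le
  let K := FiniteField.Extension F p 2
  have : Fintype K := Fintype.ofFinite K
  have hK : Fintype.card K = Fintype.card F ^ 2 := by
    rw [← Nat.card_eq_fintype_card, ← Nat.card_eq_fintype_card]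
    exact FiniteField.natCard_extension F p 2
  have hF2 := char_two_ne (F := F) (p := p) hp4
  have hq1 : 1 < Fintype.card F := Fintype.one_lt_card
  have hA := sum_formula (K := K) hF2 hK l
  have hB := sum_formula_one (K := K) hF2 hK
  have hdvd : l ∣ Fintype.card F - 1 ↔ (l - 1) ∣ n := by
    rw [← hord, orderOf_dvd_iff_pow_eq_one, ← CharP.cast_eq_zero_iff (ZMod l) l,
      Nat.cast_sub hq1.le, hF, sub_eq_zero]
    push_cast; rfl
  have hV : ¬ l ∣ Fintype.card F + 1 →
      ∑ t : V1 F K, HV F ((t ^ l : V1 F K) : Kˣ) = ∑ t : V1 F K, HV F (t : Kˣ) := fun h =>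
    sum_pow_eq hl (by rwa [card_V1 hK]) (fun t : V1 F K => HV F (t : Kˣ))
  constructor
  · intro hnd
    have h1 := sum_pow_eq (G := Fˣ) hl (by rw [Fintype.card_units, hdvd]; exact hnd)
      (fun s : Fˣ => quadraticChar F ((s : F) + (s⁻¹ : Fˣ)))
    have h2 : ∑ t : V1 F K, HV F ((t ^ l : V1 F K) : Kˣ) = ∑ t : V1 F K, HV F (t : Kˣ) := by
      by_cases h : l ∣ Fintype.card F + 1
      · have h3 : (l - 1) ∣ 2 * n := by
          rw [← hord, orderOf_dvd_iff_pow_eq_one]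
          rw [← CharP.cast_eq_zero_iff (ZMod l) l, hF] at h
          push_cast at h
          rw [mul_comm, pow_mul, eq_neg_of_add_eq_zero_left h]; norm_num
        obtain ⟨m, hm⟩ := h3
        have hn' : n = (l - 1) / 2 * m := by
          obtain ⟨c, hc⟩ : ∃ c, l - 1 = 2 * c := ⟨(l - 1) / 2, by omega⟩
          rw [hc] at hm ⊢
          rw [Nat.mul_div_cancel_left _ (by norm_num)]
          rw [mul_assoc] at hm
          omega
        have hmo : Odd m := by
          by_contra hme
          rw [Nat.not_odd_iff_even] at hme
          obtain ⟨r, hr⟩ := hme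
          apply hnd
          refine ⟨r, ?_⟩
          have : (l - 1) * m = 2 * ((l - 1) * r) := by rw [hr]; ring
          omega
        exact nonsplit_case hl hl4 hp4 hpl hgen hord hmo (by rw [hF, hn']) hK h
      · exact hV h
    rw [h1, h2, hB] at hA
    omega
  · intro m hm
    have hm0 : 0 < m := by
      rcases Nat.eq_zero_or_pos m with rfl | h
      · omega
      · exact h
    have h1 : ¬ l ∣ Fintype.card F + 1 := by
      intro hd
      have h2 := Nat.dvd_sub hd (hdvd.2 ⟨m, hm⟩)
      rw [show Fintype.card F + 1 - (Fintype.card F - 1) = 2 by omega] at h2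
      have := Nat.le_of_dvd (by norm_num) h2
      omega
    have h2 := (split_case (F := F) hl hl4 hp4 hpl hgen hord hm0 (by rw [hF, hm])).2
    rw [hV h1] at hA
    have h3 : 2 * ∑ x : F, quadraticChar F ((Polynomial.dickson 1 (1 : F) l).eval x) =
        2 * (-(((l : ℤ) - 1) * (-1) ^ m * (p : ℤ) ^ ((l - 1) / 2 * m))) := by
      linear_combination hA + h2 + hB
    exact mul_left_cancel₀ two_ne_zero h3

end

end ChebAux

theorem statement6 (l p : ℕ) (hl : l.Prime) (hl4 : l % 4 = 1)
    (hp : p.Prime) (hp4 : p % 4 = 1) (hne : p ≠ l)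
    (u : (ZMod l)ˣ) (hu : (u : ZMod l) = (p : ZMod l))
    (hprim : ∀ x : (ZMod l)ˣ, x ∈ Subgroup.zpowers u)
    (n : ℕ) (hn : 1 ≤ n) (F : Type) [Field F] [Fintype F]
    (hF : Fintype.card F = p ^ n) :
    (¬ (l - 1) ∣ n → chebAffineCount F l = p ^ n) ∧
    ((l - 1) ∣ n → (chebAffineCount F l : ℤ) =
      (p : ℤ) ^ n - (l - 1) * (-1) ^ (n / (l - 1)) * (p : ℤ) ^ (n / 2)) := by
  classical
  have : Fact p.Prime := ⟨hp⟩
  have : CharP F p := by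
    exact charP_of_card_eq_prime_pow (f := n) hF
  have hF2 := ChebAux.char_two_ne (F := F) (p := p) hp4
  have hc := ChebAux.cheb_count hF2 (dickson 1 (1 : F) l)
  have hS := ChebAux.charSum (F := F) hl hl4 hp4 hne (ChebAux.hgen_of_prim hl u hu hprim)
    (ChebAux.hord_of_prim hl u hu hprim) hn hF
  have hc2 : (chebAffineCount F l : ℤ) =
      (p : ℤ) ^ n + ∑ x : F, quadraticChar F ((dickson 1 (1 : F) l).eval x) := by
    rw [chebAffineCount, hc, hF]; push_cast; rfl
  have hl2 := hl.two_le
  constructor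
  · intro h
    rw [hS.1 h, add_zero] at hc2
    exact_mod_cast hc2
  · rintro ⟨m, hm⟩
    rw [hc2, hS.2 m hm, hm, Nat.mul_div_cancel_left _ (by omega : 0 < l - 1)]
    obtain ⟨c, hc'⟩ : ∃ c, l - 1 = 2 * c := ⟨(l - 1) / 2, by omega⟩
    rw [hc', Nat.mul_div_cancel_left _ (by norm_num), mul_assoc 2 c m,
      Nat.mul_div_cancel_left _ (by norm_num)]
    ring
end

section
/- Let ℓ be an odd prime and let p ≠ ℓ be a prime with p ≡ 1 (mod 4) which is a primitive root modulo ℓ. Write φ_ℓ(x) = x·ψ_ℓ(x) in 𝔽_p[X] (this is possible since φ_ℓ(0) = 0 for odd ℓ). Then the degree-(ℓ−1) polynomial ψ_ℓ is irreducible in 𝔽_p[X]. -/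
open Polynomial

theorem dickson_natDegree_le_aux {R : Type*} [CommRing R] (n : ℕ) :
    (dickson 1 (1 : R) n).natDegree ≤ n ∧ (dickson 1 (1 : R) (n+1)).natDegree ≤ n + 1 := by
  induction n with
  | zero =>
    refine ⟨?_, ?_⟩
    · rw [dickson_zero]
      have : (3 - ((1 : ℕ) : R[X])) = C 2 := by
        rw [show (C (2 : R)) = (2 : R[X]) from rfl]; push_cast; norm_num
      rw [this, natDegree_C]
    · rw [zero_add, dickson_one]; exact natDegree_X_le
  | succ n ih =>
    refine ⟨ih.2, ?_⟩
    rw [dickson_add_two]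
    refine (natDegree_sub_le _ _).trans (max_le ?_ ?_)
    · refine natDegree_mul_le.trans ?_
      have := natDegree_X_le (R := R)
      have := ih.2
      omega
    · refine natDegree_mul_le.trans ?_
      have := ih.1
      rw [natDegree_C]
      omega

theorem statement7 (l p : ℕ) (hl : l.Prime) (hlodd : Odd l)
    (hp : p.Prime) (hp4 : p % 4 = 1) (hne : p ≠ l)
    (u : (ZMod l)ˣ) (hu : (u : ZMod l) = (p : ZMod l))
    (hprim : ∀ x : (ZMod l)ˣ, x ∈ Subgroup.zpowers u)
    (ψ : Polynomial (ZMod p)) (hψ : X * ψ = dickson 1 (1 : ZMod p) l) :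
    Irreducible ψ := by
  have : Fact p.Prime := ⟨hp⟩
  have : Fact l.Prime := ⟨hl⟩
  have hl2 := hl.two_le
  have h2 : (2 : ZMod p) ≠ 0 := by
    intro h
    have h' : ((2 : ℕ) : ZMod p) = 0 := by exact_mod_cast h
    rw [ZMod.natCast_eq_zero_iff] at h'
    have := (Nat.prime_dvd_prime_iff_eq hp Nat.prime_two).1 h'
    omega
  obtain ⟨i, hi⟩ : IsSquare (-1 : ZMod p) := ZMod.exists_sq_eq_neg_one_iff.2 (by omega)
  have hψ0 : ψ ≠ 0 := by
    rintro rfl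
    have h := dickson_one_one_eval_add_inv (1 : ZMod p) 1 (one_mul 1) l
    rw [← hψ] at h
    simp at h
    apply h2
    rw [← one_add_one_eq_two, ← h]
  have hdeg : ψ.natDegree ≤ l - 1 := by
    have h := (dickson_natDegree_le_aux (R := ZMod p) l).1
    rw [← hψ, natDegree_X_mul hψ0] at h
    omega
  suffices key : ∀ (K : Type) [Field K] [Algebra (ZMod p) K] [IsAlgClosed K]
      [Algebra.IsAlgebraic (ZMod p) K], Irreducible ψ from key (AlgebraicClosure (ZMod p))
  intro K _ _ _ _
  have : CharP K p := charP_of_injective_algebraMap (algebraMap (ZMod p) K).injective p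
  have hlK : ((l : ℕ) : ZMod p) ≠ 0 := by
    rw [Ne, ZMod.natCast_eq_zero_iff]
    intro h
    exact hne ((Nat.prime_dvd_prime_iff_eq hp hl).1 h)
  have : NeZero ((l : ℕ) : K) := ⟨by
    rw [← map_natCast (algebraMap (ZMod p) K)]
    exact (_root_.map_ne_zero _).2 hlK⟩
  have h2K : (2 : K) ≠ 0 := by
    rw [← map_ofNat (algebraMap (ZMod p) K) 2]
    exact (_root_.map_ne_zero _).2 h2
  obtain ⟨ζ, hζ⟩ := HasEnoughRootsOfUnity.exists_primitiveRoot K l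
  have hζ0 : ζ ≠ 0 := hζ.ne_zero (by omega)
  set I : K := algebraMap (ZMod p) K i with hI
  have hII : I * I = -1 := by rw [hI, ← map_mul, ← hi]; simp
  have hI0 : I ≠ 0 := by
    intro h; rw [h] at hII; simp at hII
  have hIp : ∀ k : ℕ, I ^ p ^ k = I := by
    intro k
    rw [hI, ← map_pow, ZMod.pow_card_pow]
  let β : ℕ → K := fun j => I * (ζ ^ j - (ζ ^ j)⁻¹)
  have hinj : ∀ a b : ℕ, β a = β b → ζ ^ a = ζ ^ b := by
    intro a b h
    have h := mul_left_cancel₀ hI0 h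
    have ha : ζ ^ a ≠ 0 := pow_ne_zero _ hζ0
    have hb : ζ ^ b ≠ 0 := pow_ne_zero _ hζ0
    field_simp at h
    have h' : (ζ ^ a - ζ ^ b) * (ζ ^ (a + b) + 1) = 0 := by
      rw [pow_add]; linear_combination h
    rcases mul_eq_zero.1 h' with h' | h'
    · exact sub_eq_zero.1 h'
    · exfalso
      have h1 : ζ ^ (a + b) = -1 := eq_neg_of_add_eq_zero_left h'
      have h3 : (ζ ^ (a + b)) ^ l = 1 := by rw [← pow_mul, mul_comm, pow_mul, hζ.pow_eq_one, one_pow]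
      rw [h1, hlodd.neg_one_pow] at h3
      apply h2K
      linear_combination -h3
  have hα0 : β 1 ≠ 0 := by
    intro h
    have : β 1 = β 0 := by rw [h]; simp [β]
    have := hinj _ _ this
    rw [pow_one, pow_zero] at this
    exact hζ.ne_one (by omega) this
  have hroot : aeval (β 1) ψ = 0 := by
    have h := dickson_one_one_eval_add_inv (I * ζ) (-I * ζ⁻¹)
      (by field_simp; linear_combination -hII) l
    have e : I * ζ + -I * ζ⁻¹ = β 1 := by simp only [β, pow_one]; ring
    rw [e, mul_pow, mul_pow, inv_pow, hζ.pow_eq_one, hlodd.neg_pow] at h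
    have hm : (dickson 1 (1 : K) l) = (X * ψ).map (algebraMap (ZMod p) K) := by
      rw [hψ, map_dickson, map_one]
    rw [hm, Polynomial.map_mul, map_X, eval_mul, eval_X, eval_map_algebraMap] at h
    have h4 : β 1 * aeval (β 1) ψ = 0 := by rw [h]; simp
    exact (mul_eq_zero.1 h4).resolve_left hα0
  have hintegral : IsIntegral (ZMod p) (β 1) := Algebra.IsIntegral.isIntegral _
  set m := minpoly (ZMod p) (β 1) with hm
  have hm0 : m ≠ 0 := minpoly.ne_zero hintegral
  have hfrob : ∀ k : ℕ, aeval ((β 1) ^ p ^ k) m = 0 := by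
    intro k
    have := ZMod.expand_card (p := p)
    induction k with
    | zero => rw [pow_zero, pow_one]; exact minpoly.aeval _ _
    | succ k ih =>
      rw [pow_succ p, pow_mul, ← expand_aeval, ZMod.expand_card, map_pow, ih, zero_pow hp.ne_zero]
  have hroots : ∀ j ∈ Finset.Ico 1 l, aeval (β j) m = 0 := by
    intro j hj
    rw [Finset.mem_Ico] at hj
    have hj0 : (j : ZMod l) ≠ 0 := by
      rw [Ne, ZMod.natCast_eq_zero_iff]
      intro h
      have := Nat.le_of_dvd (by omega) h
      omega
    have hz := hprim (Units.mk0 _ hj0)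
    rw [← mem_powers_iff_mem_zpowers] at hz
    obtain ⟨k, hk⟩ := hz
    have hk' : ((p ^ k : ℕ) : ZMod l) = (j : ZMod l) := by
      have := congrArg Units.val hk
      simpa [hu] using this
    rw [ZMod.natCast_eq_natCast_iff] at hk'
    have hpow : ζ ^ p ^ k = ζ ^ j := by
      rw [← pow_mod_orderOf ζ (p ^ k), ← pow_mod_orderOf ζ j, ← hζ.eq_orderOf]; rw [hk']
    have : β j = β 1 ^ p ^ k := by
      simp only [β, pow_one]
      rw [mul_pow, hIp, sub_pow_char_pow, inv_pow, hpow]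
    rw [this]
    exact hfrob k
  have hcard : l - 1 ≤ m.natDegree := by
    classical
    have hsub : ((Finset.Ico 1 l).image β) ⊆ (m.map (algebraMap (ZMod p) K)).roots.toFinset := by
      intro x hx
      obtain ⟨j, hj, rfl⟩ := Finset.mem_image.1 hx
      rw [Multiset.mem_toFinset, mem_roots (Polynomial.map_ne_zero hm0), IsRoot,
        eval_map_algebraMap]
      exact hroots j hj
    have h5 := Finset.card_le_card hsub
    rw [Finset.card_image_of_injOn, Nat.card_Ico] at h5
    · refine h5.trans ((Multiset.toFinset_card_le _).trans ((card_roots' _).trans ?_))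
      exact natDegree_map_le
    · intro a ha b hb hab
      rw [Finset.mem_coe, Finset.mem_Ico] at ha hb
      exact hζ.pow_inj ha.2 hb.2 (hinj a b hab)
  have hdvd : m ∣ ψ := minpoly.dvd _ _ hroot
  have hassoc : Associated m ψ :=
    associated_of_dvd_of_natDegree_le hdvd hψ0 (hdeg.trans hcard)
  exact hassoc.irreducible (minpoly.irreducible hintegral)
end

section
/- (Dickson) Let p be an odd prime, let d be an odd positive integer, and let n ≥ 1 be an integer such that gcd(p^{2n} − 1, d) = 1. Then the map 𝔽_{p^n} → 𝔽_{p^n} given by t ↦ φ_d(t) (evaluation of the polynomial φ_d) is a bijection. -/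
open Polynomial

theorem statement8 (p d n : ℕ) (hp : p.Prime) (hpodd : Odd p)
    (hd : Odd d) (hdpos : 0 < d) (hn : 1 ≤ n)
    (hgcd : Nat.gcd (p ^ (2 * n) - 1) d = 1)
    (F : Type) [Field F] [Fintype F] (hF : Fintype.card F = p ^ n) :
    Function.Bijective (fun t : F => (dickson 1 (1 : F) d).eval t) := by
  have hp2 := hp.two_le
  have hq2 : 2 ≤ p ^ n := hp2.trans (Nat.le_self_pow (by omega) p)
  have hQ : p ^ (2 * n) = p ^ n * p ^ n := by rw [two_mul, pow_add]
  have hm : 1 < p ^ (2 * n) - 1 := by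
    have : 2 * 2 ≤ p ^ (2 * n) := by rw [hQ]; exact Nat.mul_le_mul hq2 hq2
    omega
  obtain ⟨e, -, he⟩ := Nat.exists_mul_mod_eq_one_of_coprime (Nat.coprime_comm.1 hgcd) hm
  set m := p ^ (2 * n) - 1 with hmdef
  have hmQ : m + 1 = p ^ n * p ^ n := by omega
  have hk : e * d = m * (d * e / m) + 1 := by
    have := Nat.div_add_mod (d * e) m
    rw [he] at this
    rw [mul_comm e d]; exact this.symm
  set k := d * e / m
  apply Finite.injective_iff_bijective.1
  apply Function.LeftInverse.injective (g := fun t : F => (dickson 1 (1 : F) e).eval t)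
  intro t
  show (dickson 1 (1 : F) e).eval ((dickson 1 (1 : F) d).eval t) = t
  rw [← eval_comp, ← dickson_one_one_mul]
  let K := AlgebraicClosure F
  let f : F →+* K := algebraMap F K
  apply f.injective
  rw [← eval_map_apply, map_dickson, map_one]
  have htq : f t ^ p ^ n = f t := by
    rw [← map_pow, ← hF, FiniteField.pow_card]
  obtain ⟨x, hx⟩ : ∃ x : K, x * x - f t * x + 1 = 0 := by
    obtain ⟨x, hx⟩ := IsAlgClosed.exists_root (X ^ 2 + C (-f t) * X + C 1 : K[X]) (by
      have : (X ^ 2 + C (-f t) * X + C 1 : K[X]).degree = 2 := by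
        simpa using degree_quadratic (a := (1 : K)) (b := -f t) (c := 1) one_ne_zero
      rw [this]; decide)
    refine ⟨x, ?_⟩
    simp [IsRoot] at hx
    linear_combination hx
  have hxy : x * (f t - x) = 1 := by linear_combination -hx
  set y := f t - x with hy
  have hxyt : f t = x + y := by rw [hy]; ring
  have hchar : CharP F p := by
    have := Fact.mk hp
    exact charP_of_card_eq_prime_pow hF
  have : CharP K p := charP_of_injective_algebraMap f.injective p
  have : Fact p.Prime := ⟨hp⟩
  have hxyq : x ^ p ^ n * y ^ p ^ n = 1 := by rw [← mul_pow, hxy, one_pow]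
  have hsum : x ^ p ^ n + y ^ p ^ n = x + y := by
    rw [← add_pow_char_pow, ← hxyt, htq]
  have hx0 : x ≠ 0 := left_ne_zero_of_mul_eq_one hxy
  have hcase : (x ^ p ^ n - x) * (x ^ p ^ n - y) = 0 := by
    linear_combination x ^ p ^ n * hsum - hxyq + hxy
  have hQx : x ^ (m + 1) = x := by
    rw [hmQ, pow_mul]
    rcases mul_eq_zero.1 hcase with h | h
    · rw [sub_eq_zero.1 h, sub_eq_zero.1 h]
    · have h' := sub_eq_zero.1 h
      rw [h']
      rw [h'] at hsum
      linear_combination hsum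
  have hmx : x ^ m = 1 := by
    rw [pow_succ] at hQx
    exact mul_right_cancel₀ hx0 (by rw [hQx, one_mul])
  have hmy : y ^ m = 1 := by
    have : x ^ m * y ^ m = 1 := by rw [← mul_pow, hxy, one_pow]
    rwa [hmx, one_mul] at this
  rw [hxyt, dickson_one_one_eval_add_inv x y hxy, hk, pow_succ, pow_succ, pow_mul, pow_mul,
    hmx, hmy]
  simp
end

section
/- Let p be an odd prime, let d be an odd positive integer, and let n ≥ 1 be an integer such that gcd(p^{2n} − 1, d) = 1. Then #{(x,y) ∈ 𝔽_{p^n} × 𝔽_{p^n} : y² = φ_d(x)} = p^n; equivalently, the curve H_d satisfies #H_d(𝔽_{p^n}) = p^n + 1. -/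
open Polynomial

lemma cheb_exists_param {F K : Type*} [Field F] [Fintype F] [Field K] [Algebra F K] [IsAlgClosed K]
    (a : F) : ∃ x : K, x ≠ 0 ∧ x + x⁻¹ = algebraMap F K a ∧
      x ^ (Fintype.card F ^ 2 - 1) = 1 := by
  obtain ⟨x, hx⟩ := IsAlgClosed.exists_root (X ^ 2 - C (algebraMap F K a) * X + 1 : K[X]) (by
    have : (X ^ 2 - C (algebraMap F K a) * X + 1 : K[X]).degree = 2 := by compute_degree!
    rw [this]; norm_num)
  simp only [IsRoot, eval_add, eval_sub, eval_pow, eval_X, eval_mul, eval_C, eval_one] at hx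
  have hx0 : x ≠ 0 := by
    rintro rfl
    simp at hx
  have hsum : x + x⁻¹ = algebraMap F K a := by
    field_simp
    linear_combination hx
  refine ⟨x, hx0, hsum, ?_⟩
  set q := Fintype.card F with hq
  have hfr := (FiniteField.frobeniusAlgHom F K).commutes a
  rw [← hsum, map_add, map_inv₀] at hfr
  simp only [FiniteField.coe_frobeniusAlgHom] at hfr
  rw [← hq] at hfr
  have hw0 : x ^ q ≠ 0 := pow_ne_zero _ hx0
  have h1 : (x ^ q - x) * (x ^ q - x⁻¹) = 0 := by
    field_simp at hfr ⊢
    linear_combination hfr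
  have h2 : x ^ (q ^ 2) = x := by
    rw [sq, pow_mul]
    rcases mul_eq_zero.1 h1 with h | h
    · rw [sub_eq_zero.1 h, sub_eq_zero.1 h]
    · rw [sub_eq_zero.1 h, inv_pow, sub_eq_zero.1 h, inv_inv]
  have hqpos : 0 < q ^ 2 := pow_pos Fintype.card_pos _
  apply mul_right_cancel₀ hx0
  rw [← pow_succ, Nat.sub_add_cancel hqpos, h2, one_mul]

lemma cheb_injective {F : Type*} [Field F] [Fintype F] (d : ℕ)
    (h : Nat.gcd (Fintype.card F ^ 2 - 1) d = 1) :
    Function.Injective fun a : F => (dickson 1 (1 : F) d).eval a := by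
  intro a b hab
  obtain ⟨x, hx0, hxs, hx1⟩ := cheb_exists_param (K := AlgebraicClosure F) a
  obtain ⟨z, hz0, hzs, hz1⟩ := cheb_exists_param (K := AlgebraicClosure F) b
  have key : ∀ u : AlgebraicClosure F, u ^ (Fintype.card F ^ 2 - 1) = 1 → u ^ d = 1 → u = 1 := by
    intro u h1 h2
    have h3 := Nat.dvd_gcd (orderOf_dvd_of_pow_eq_one h1) (orderOf_dvd_of_pow_eq_one h2)
    rw [h, Nat.dvd_one] at h3
    exact orderOf_eq_one_iff.1 h3
  have ev : ∀ c : F, algebraMap F (AlgebraicClosure F) ((dickson 1 (1 : F) d).eval c) =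
      (dickson 1 (1 : AlgebraicClosure F) d).eval (algebraMap F _ c) := by
    intro c
    rw [← map_one (algebraMap F (AlgebraicClosure F)), ← map_dickson, eval_map_algebraMap,
      aeval_algebraMap_apply_eq_algebraMap_eval]
  have h4 := congrArg (algebraMap F (AlgebraicClosure F)) hab
  simp only at h4
  rw [ev, ev, ← hxs, ← hzs, dickson_one_one_eval_add_inv _ _ (mul_inv_cancel₀ hx0),
    dickson_one_one_eval_add_inv _ _ (mul_inv_cancel₀ hz0), inv_pow, inv_pow] at h4
  have hX : x ^ d ≠ 0 := pow_ne_zero _ hx0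
  have hZ : z ^ d ≠ 0 := pow_ne_zero _ hz0
  apply FaithfulSMul.algebraMap_injective F (AlgebraicClosure F)
  rw [← hxs, ← hzs]
  have h5 : (x ^ d - z ^ d) * (x ^ d * z ^ d - 1) = 0 := by
    field_simp at h4
    linear_combination h4
  rcases mul_eq_zero.1 h5 with h6 | h6
  · have := key (x / z) (by rw [div_pow, hx1, hz1, div_one])
      (by rw [div_pow, sub_eq_zero.1 h6, div_self hZ])
    rw [div_eq_one_iff_eq hz0] at this
    rw [this]
  · have := key (x * z) (by rw [mul_pow, hx1, hz1, one_mul])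
      (by rw [mul_pow, sub_eq_zero.1 h6])
    rw [eq_inv_of_mul_eq_one_left this, inv_inv, add_comm]

theorem statement9 (p d n : ℕ) (hp : p.Prime) (hpodd : Odd p)
    (hd : Odd d) (hdpos : 0 < d) (hn : 1 ≤ n)
    (hgcd : Nat.gcd (p ^ (2 * n) - 1) d = 1)
    (F : Type) [Field F] [Fintype F] (hF : Fintype.card F = p ^ n) :
    chebAffineCount F d = p ^ n := by

  have hinj : Function.Injective fun a : F => (dickson 1 (1 : F) d).eval a := by
    apply cheb_injective
    rw [hF, ← pow_mul, mul_comm n 2, hgcd]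
  have hbij := Finite.injective_iff_bijective.1 hinj
  rw [chebAffineCount, ← hF, ← Nat.card_eq_fintype_card]
  apply Nat.card_congr
  refine Equiv.ofBijective (fun s => s.1.2) ⟨?_, ?_⟩
  · rintro ⟨⟨x, y⟩, h⟩ ⟨⟨x', y'⟩, h'⟩ (rfl : y = y')
    have : x = x' := hinj (h.symm.trans h')
    subst this
    rfl
  · intro y
    obtain ⟨x, hx⟩ := hbij.2 (y ^ 2)
    exact ⟨⟨⟨x, y⟩, hx.symm⟩, rfl⟩
end
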